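/- Let A be a unital simple separable C*-algebra which is approximately divisible, of real rank zero, and stably finite, and assume that C(X,A) has strict comparison of positive elements with respect to tracial states for every compact metric space X (in the paper this follows from exactness together with approximate divisibility). Let a ∈ A be a nonzero positive element whose Cuntz class is not compact, i.e., σ(a) ∩ (0, ε) ≠ ∅ for every ε > 0. Then for every compact metric space X the set D_{a,X} = { f ∈ C(X,A) : f ≥ 0 and f(x) is Cuntz equivalent to a for every x ∈ X } is path connected in the norm topology of C(X,A). -/

import Mathlib

open Filter Topology

/-- Cuntz subequivalence: `a ≾ b` iff there is a sequence `vₙ` with `‖vₙ * b * vₙ* - a‖ → 0`. -/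
def CuntzLE {B : Type*} [NonUnitalNormedRing B] [StarRing B] (a b : B) : Prop :=
  ∃ v : ℕ → B, Tendsto (fun n => ‖v n * b * star (v n) - a‖) atTop (𝓝 0)

/-- Cuntz equivalence: `a ≾ b` and `b ≾ a`. -/
def CuntzEquiv {B : Type*} [NonUnitalNormedRing B] [StarRing B] (a b : B) : Prop :=
  CuntzLE a b ∧ CuntzLE b a

/-- A projection: a self-adjoint idempotent. -/
def IsProjection {B : Type*} [Mul B] [Star B] (p : B) : Prop :=
  star p = p ∧ p * p = p

/-- Murray–von Neumann equivalence of projections. -/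
def MvNEquiv {B : Type*} [Mul B] [Star B] (p q : B) : Prop :=
  ∃ v : B, star v * v = p ∧ v * star v = q

/-- A tracial state on a unital C*-algebra: a unital positive linear functional `τ`
with `τ(xy) = τ(yx)`. -/
def IsTracialState {B : Type*} [CStarAlgebra B] [PartialOrder B] (τ : B → ℂ) : Prop :=
  (∀ x y : B, τ (x + y) = τ x + τ y) ∧ (∀ (c : ℂ) (x : B), τ (c • x) = c * τ x) ∧
  τ 1 = 1 ∧ (∀ a : B, 0 ≤ a → 0 ≤ (τ a).re ∧ (τ a).im = 0) ∧
  (∀ x y : B, τ (x * y) = τ (y * x))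

/-- The dimension function `d_τ(a) = lim_{n→∞} τ(a^{1/n})` associated to a tracial state,
with `a^{1/n}` given by the continuous functional calculus. -/
noncomputable def dTr {B : Type*} [CStarAlgebra B] (τ : B → ℂ) (a : B) : ℝ :=
  limUnder atTop (fun n : ℕ => (τ (cfc (fun t : ℝ => t ^ (n : ℝ)⁻¹) a)).re)

/-- Strict comparison of positive elements with respect to tracial states:
`a ≾ b` whenever `d_τ(a) < d_τ(b)` for every tracial state `τ`. -/
def StrictComparison (B : Type*) [CStarAlgebra B] [PartialOrder B] : Prop :=
  ∀ a b : B, 0 ≤ a → 0 ≤ b →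
    (∀ τ : B → ℂ, IsTracialState τ → dTr τ a < dTr τ b) → CuntzLE a b

/-- A unital C*-algebra is approximately divisible if for each `N` there is an
approximately central sequence of unital *-homomorphisms `M_N(ℂ) ⊕ M_{N+1}(ℂ) → A`. -/
def ApproxDivisible (A : Type*) [CStarAlgebra A] : Prop :=
  ∀ N : ℕ, ∃ φ : ℕ → ((Matrix (Fin N) (Fin N) ℂ × Matrix (Fin (N + 1)) (Fin (N + 1)) ℂ) →⋆ₐ[ℂ] A),
    ∀ z, ∀ a : A, Tendsto (fun k => ‖φ k z * a - a * φ k z‖) atTop (𝓝 0)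

/-- Real rank zero: every self-adjoint element is a norm limit of self-adjoint
elements with finite spectrum. -/
def RealRankZero (A : Type*) [CStarAlgebra A] : Prop :=
  ∀ a : A, IsSelfAdjoint a → ∀ ε : ℝ, 0 < ε →
    ∃ b : A, IsSelfAdjoint b ∧ (spectrum ℂ b).Finite ∧ ‖a - b‖ < ε

/-- Stably finite: every isometry in every matrix algebra over `A` is a unitary. -/
def StablyFinite (A : Type*) [CStarAlgebra A] : Prop :=
  ∀ n : ℕ, ∀ v : Matrix (Fin n) (Fin n) A, star v * v = 1 → v * star v = 1

/-- Simplicity: no nontrivial closed two-sided ideals. -/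
def CStarSimple (A : Type*) [CStarAlgebra A] : Prop :=
  ∀ I : TwoSidedIdeal A, IsClosed (I : Set A) → I = ⊥ ∨ I = ⊤

/-- The hereditary subalgebra generated by a positive element `f`: the norm closure
of `{ f x f : x ∈ B }`. -/
def herSet {B : Type*} [NonUnitalNormedRing B] (f : B) : Set B :=
  closure {y : B | ∃ x : B, y = f * x * f}

lemma cuntzLE_refl {B : Type*} [NormedRing B] [StarRing B] (a : B) : CuntzLE a a :=
  ⟨fun _ => 1, by simp⟩

lemma cuntzEquiv_refl {B : Type*} [NormedRing B] [StarRing B] (a : B) : CuntzEquiv a a :=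
  ⟨cuntzLE_refl a, cuntzLE_refl a⟩

section CStarBasics

variable {B : Type*} [CStarAlgebra B] [PartialOrder B] [StarOrderedRing B]

lemma spectrum_nonneg_of_mem {a : B} (ha : 0 ≤ a) {t : ℝ} (ht : t ∈ spectrum ℝ a) : 0 ≤ t :=
  spectrum_nonneg_of_nonneg ha ht

/-- The resolvent `(a + δ)⁻¹` of a positive element. -/
noncomputable def resolventPos (δ : ℝ) (a : B) : B := cfc (fun t : ℝ => (t + δ)⁻¹) a

/-- The element `a (a + δ)⁻¹`, a bounded substitute for the support projection of `a`. -/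
noncomputable def softSupport (δ : ℝ) (a : B) : B := cfc (fun t : ℝ => t / (t + δ)) a

lemma continuousOn_resolventPos {a : B} (ha : 0 ≤ a) {δ : ℝ} (hδ : 0 < δ) :
    ContinuousOn (fun t : ℝ => (t + δ)⁻¹) (spectrum ℝ a) := by
  refine ContinuousOn.inv₀ (by fun_prop) fun t ht => ?_
  have := spectrum_nonneg_of_mem ha ht
  positivity

lemma continuousOn_softSupport {a : B} (ha : 0 ≤ a) {δ : ℝ} (hδ : 0 < δ) :
    ContinuousOn (fun t : ℝ => t / (t + δ)) (spectrum ℝ a) := by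
  refine ContinuousOn.div (by fun_prop) (by fun_prop) fun t ht => ?_
  have := spectrum_nonneg_of_mem ha ht
  positivity

lemma softSupport_eq_mul {a : B} (ha : 0 ≤ a) {δ : ℝ} (hδ : 0 < δ) :
    softSupport δ a = a * resolventPos δ a := by
  have h := cfc_mul (fun t : ℝ => t) (fun t : ℝ => (t + δ)⁻¹) a
    (by fun_prop) (continuousOn_resolventPos ha hδ)
  rw [cfc_id' ℝ a] at h
  rw [resolventPos, ← h]
  rfl

lemma softSupport_eq_mul' {a : B} (ha : 0 ≤ a) {δ : ℝ} (hδ : 0 < δ) :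
    softSupport δ a = resolventPos δ a * a := by
  have h := cfc_mul (fun t : ℝ => (t + δ)⁻¹) (fun t : ℝ => t) a
    (continuousOn_resolventPos ha hδ) (by fun_prop)
  rw [cfc_id' ℝ a] at h
  rw [resolventPos, ← h, softSupport]
  congr 1
  ext t
  rw [div_eq_inv_mul]

lemma resolventPos_mul_add {a : B} (ha : 0 ≤ a) {δ : ℝ} (hδ : 0 < δ) :
    resolventPos δ a * (a + algebraMap ℝ B δ) = 1 := by
  have h := cfc_mul (fun t : ℝ => (t + δ)⁻¹) (fun t : ℝ => t + δ) a
    (continuousOn_resolventPos ha hδ) (by fun_prop)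
  rw [cfc_add_const δ (fun t : ℝ => t) a, cfc_id' ℝ a] at h
  rw [resolventPos, ← h, ← cfc_one ℝ a]
  refine cfc_congr fun t ht => ?_
  have := spectrum_nonneg_of_mem ha ht
  simp only [Pi.one_apply]
  field_simp

lemma add_mul_resolventPos {a : B} (ha : 0 ≤ a) {δ : ℝ} (hδ : 0 < δ) :
    (a + algebraMap ℝ B δ) * resolventPos δ a = 1 := by
  have h := softSupport_eq_mul ha hδ
  have h2 := softSupport_eq_mul' ha hδ
  have h3 := resolventPos_mul_add ha hδ
  rw [mul_add, ← h2, h, ← Algebra.commutes, ← add_mul] at h3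
  exact h3

lemma resolventPos_eq_of_mul_eq_one {a r : B} (ha : 0 ≤ a) {δ : ℝ} (hδ : 0 < δ)
    (h : (a + algebraMap ℝ B δ) * r = 1) : resolventPos δ a = r :=
  left_inv_eq_right_inv (resolventPos_mul_add ha hδ) h

lemma softSupport_eq_one_sub {a : B} (ha : 0 ≤ a) {δ : ℝ} (hδ : 0 < δ) :
    softSupport δ a = 1 - δ • resolventPos δ a := by
  rw [softSupport_eq_mul' ha hδ, ← resolventPos_mul_add ha hδ, mul_add, ← Algebra.commutes,
    ← Algebra.smul_def, add_sub_cancel_right]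

lemma resolventPos_anti {a b : B} (ha : 0 ≤ a) (hab : a ≤ b) {δ : ℝ} (hδ : 0 < δ) :
    resolventPos δ b ≤ resolventPos δ a := by
  have hb := ha.trans hab
  have key : ∀ c : B, 0 ≤ c → resolventPos δ c = Ring.inverse (c + algebraMap ℝ B δ) := by
    intro c hc
    let u : Bˣ := ⟨c + algebraMap ℝ B δ, resolventPos δ c, add_mul_resolventPos hc hδ,
      resolventPos_mul_add hc hδ⟩
    exact (Ring.inverse_unit u).symm
  rw [key a ha, key b hb]
  have hu : IsUnit (a + algebraMap ℝ B δ) :=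
    ⟨⟨a + algebraMap ℝ B δ, resolventPos δ a, add_mul_resolventPos ha hδ,
      resolventPos_mul_add ha hδ⟩, rfl⟩
  exact CStarAlgebra.ringInverse_le_ringInverse (by gcongr)
    ⟨add_nonneg ha (algebraMap_nonneg B hδ.le), hu⟩

lemma softSupport_mono {a b : B} (ha : 0 ≤ a) (hab : a ≤ b) {δ : ℝ} (hδ : 0 < δ) :
    softSupport δ a ≤ softSupport δ b := by
  rw [softSupport_eq_one_sub ha hδ, softSupport_eq_one_sub (ha.trans hab) hδ]
  have := resolventPos_anti ha hab hδ
  gcongr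

lemma softSupport_smul {a : B} (ha : 0 ≤ a) {c δ : ℝ} (hc : 0 < c) (hδ : 0 < δ) :
    softSupport δ (c • a) = softSupport (δ / c) a := by
  have hca : 0 ≤ c • a := smul_nonneg hc.le ha
  have hdc : 0 < δ / c := by positivity
  rw [softSupport_eq_one_sub hca hδ, softSupport_eq_one_sub ha hdc]
  have : resolventPos δ (c • a) = c⁻¹ • resolventPos (δ / c) a := by
    apply resolventPos_eq_of_mul_eq_one hca hδ
    have h1 : c • a + algebraMap ℝ B δ = c • (a + algebraMap ℝ B (δ / c)) := by
      rw [smul_add, Algebra.algebraMap_eq_smul_one, Algebra.algebraMap_eq_smul_one, smul_smul,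
        mul_div_cancel₀ _ hc.ne']
    rw [h1, smul_mul_smul_comm, mul_inv_cancel₀ hc.ne', one_smul, add_mul_resolventPos ha hdc]
  rw [this, smul_smul, div_eq_mul_inv]

lemma softSupport_add_algebraMap_le {a : B} (ha : 0 ≤ a) {ε δ : ℝ} (hε : 0 ≤ ε) (hδ : 0 < δ) :
    softSupport δ (a + algebraMap ℝ B ε) ≤ softSupport δ a + algebraMap ℝ B (ε / δ) := by
  have haε : 0 ≤ a + algebraMap ℝ B ε := add_nonneg ha (algebraMap_nonneg B hε)
  have hd : 0 < ε + δ := by positivity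
  have h1 : resolventPos δ (a + algebraMap ℝ B ε) = resolventPos (ε + δ) a := by
    apply resolventPos_eq_of_mul_eq_one haε hδ
    rw [add_assoc, ← map_add, add_mul_resolventPos ha hd]
  have h2 : δ • resolventPos δ a - δ • resolventPos (ε + δ) a ≤ algebraMap ℝ B (ε / δ) := by
    rw [resolventPos, resolventPos, ← cfc_smul _ _ _ (continuousOn_resolventPos ha hδ),
      ← cfc_smul _ _ _ (continuousOn_resolventPos ha hd),
      ← cfc_sub (fun t : ℝ => δ • (t + δ)⁻¹) (fun t : ℝ => δ • (t + (ε + δ))⁻¹) a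
        ((continuousOn_resolventPos ha hδ).const_smul δ)
        ((continuousOn_resolventPos ha hd).const_smul δ)]
    refine cfc_le_algebraMap _ _ _ (fun t ht => ?_)
      (((continuousOn_resolventPos ha hδ).const_smul δ).sub
        ((continuousOn_resolventPos ha hd).const_smul δ))
    have ht0 := spectrum_nonneg_of_mem ha ht
    simp only [smul_eq_mul]
    have e1 : δ * (t + δ)⁻¹ - δ * (t + (ε + δ))⁻¹ = ε * (δ / (t + δ)) / (t + (ε + δ)) := by
      field_simp
      ring
    rw [e1]
    gcongr
    · apply mul_le_of_le_one_right hε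
      rw [div_le_one (by positivity)]
      linarith
    · linarith
  rw [softSupport_eq_one_sub haε hδ, softSupport_eq_one_sub ha hδ, h1]
  have h3 := sub_le_iff_le_add.mp h2
  rw [sub_add_eq_add_sub, sub_le_sub_iff]
  rw [add_assoc, ]
  gcongr

/-- `x (x*x + δ)⁻¹ = (xx* + δ)⁻¹ x`. -/
lemma mul_resolventPos_star_mul (x : B) {δ : ℝ} (hδ : 0 < δ) :
    x * resolventPos δ (star x * x) = resolventPos δ (x * star x) * x := by
  have h1 := add_mul_resolventPos (star_mul_self_nonneg x) hδ
  have h2 := resolventPos_mul_add (mul_star_self_nonneg x) hδ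
  have h3 : (x * star x + algebraMap ℝ B δ) * x = x * (star x * x + algebraMap ℝ B δ) := by
    rw [add_mul, mul_add, Algebra.commutes, mul_assoc]
  calc x * resolventPos δ (star x * x)
      = resolventPos δ (x * star x) * ((x * star x + algebraMap ℝ B δ) * x)
          * resolventPos δ (star x * x) := by rw [← mul_assoc, h2, one_mul]
    _ = resolventPos δ (x * star x) * x := by rw [h3, mul_assoc, mul_assoc, h1, mul_one]

end CStarBasics

section CuntzBasics

variable {B : Type*} [CStarAlgebra B]

lemma cuntzLE_iff {a b : B} :
    CuntzLE a b ↔ ∀ ε : ℝ, 0 < ε → ∃ v : B, ‖v * b * star v - a‖ < ε := by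
  constructor
  · rintro ⟨v, hv⟩ ε hε
    obtain ⟨n, hn⟩ := (hv.eventually (gt_mem_nhds hε)).exists
    exact ⟨v n, hn⟩
  · intro h
    choose v hv using fun n : ℕ => h (1 / ((n : ℝ) + 1)) (by positivity)
    exact ⟨v, squeeze_zero (fun _ => norm_nonneg _) (fun n => (hv n).le)
      tendsto_one_div_add_atTop_nhds_zero_nat⟩

lemma CuntzLE.trans {a b c : B} (hab : CuntzLE a b) (hbc : CuntzLE b c) : CuntzLE a c := by
  rw [cuntzLE_iff] at *
  intro ε hε
  obtain ⟨v, hv⟩ := hab (ε / 2) (by positivity)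
  obtain ⟨w, hw⟩ := hbc (ε / 2 / (‖v‖ * ‖v‖ + 1)) (by positivity)
  refine ⟨v * w, ?_⟩
  have e : v * w * c * star (v * w) - a
      = v * (w * c * star w - b) * star v + (v * b * star v - a) := by
    rw [star_mul]; noncomm_ring
  have h1 : ‖v * (w * c * star w - b) * star v‖ ≤ (‖v‖ * ‖v‖) * ‖w * c * star w - b‖ := by
    calc _ ≤ ‖v‖ * ‖w * c * star w - b‖ * ‖star v‖ :=
          (norm_mul_le _ _).trans (by gcongr; exact norm_mul_le _ _)
      _ = _ := by rw [norm_star]; ring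
  have h2 : (‖v‖ * ‖v‖) * ‖w * c * star w - b‖ ≤ ε / 2 := by
    rw [lt_div_iff₀ (by positivity)] at hw
    nlinarith [norm_nonneg (w * c * star w - b)]
  rw [e]
  linarith [norm_add_le (v * (w * c * star w - b) * star v) (v * b * star v - a)]

lemma CuntzEquiv.trans {a b c : B} (h : CuntzEquiv a b) (h' : CuntzEquiv b c) :
    CuntzEquiv a c := ⟨h.1.trans h'.1, h'.2.trans h.2⟩

/-- The closed left ideal generated by `b`. -/
def closedLeftIdeal (b : B) : Ideal B := (Ideal.span {b}).closure

lemma mem_closedLeftIdeal_iff {x b : B} :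
    x ∈ closedLeftIdeal b ↔ ∀ ε : ℝ, 0 < ε → ∃ y : B, ‖x - y * b‖ < ε := by
  have : x ∈ closedLeftIdeal b ↔ x ∈ closure ((Ideal.span {b} : Ideal B) : Set B) := Iff.rfl
  rw [this, Metric.mem_closure_iff]
  simp only [SetLike.mem_coe, Ideal.mem_span_singleton', dist_eq_norm]
  constructor
  · intro h ε hε
    obtain ⟨_, ⟨y, rfl⟩, hy⟩ := h ε hε
    exact ⟨y, hy⟩
  · intro h ε hε
    obtain ⟨y, hy⟩ := h ε hε
    exact ⟨_, ⟨y, rfl⟩, hy⟩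

lemma isClosed_closedLeftIdeal (b : B) : IsClosed (closedLeftIdeal b : Set B) :=
  isClosed_closure

lemma self_mem_closedLeftIdeal (b : B) : b ∈ closedLeftIdeal b :=
  mem_closedLeftIdeal_iff.2 fun ε hε => ⟨1, by simpa using hε⟩

lemma closedLeftIdeal_le {a b : B} (h : a ∈ closedLeftIdeal b) :
    closedLeftIdeal a ≤ closedLeftIdeal b := by
  intro x hx
  have : closure ((Ideal.span {a} : Ideal B) : Set B) ⊆ closedLeftIdeal b := by
    apply closure_minimal _ (isClosed_closedLeftIdeal b)
    have := (Ideal.span_singleton_le_iff_mem (closedLeftIdeal b)).2 h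
    exact this
  exact this hx

variable [PartialOrder B] [StarOrderedRing B]

lemma star_sqrt (a : B) : star (CFC.sqrt a) = CFC.sqrt a :=
  (IsSelfAdjoint.of_nonneg (CFC.sqrt_nonneg a)).star_eq

lemma norm_mul_resolventPos_mul_resolventPos_le {a : B} (ha : 0 ≤ a) {δ : ℝ} (hδ : 0 < δ) :
    ‖(δ • resolventPos δ a) * a * (δ • resolventPos δ a)‖ ≤ δ := by
  have hr : ContinuousOn (fun t : ℝ => δ • (t + δ)⁻¹) (spectrum ℝ a) :=
    (continuousOn_resolventPos ha hδ).const_smul δ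
  have e : (δ • resolventPos δ a) * a * (δ • resolventPos δ a)
      = cfc (fun t : ℝ => (δ • (t + δ)⁻¹) * t * (δ • (t + δ)⁻¹)) a := by
    rw [cfc_mul (fun t : ℝ => (δ • (t + δ)⁻¹) * t) (fun t : ℝ => δ • (t + δ)⁻¹) a
      (hr.mul (by fun_prop)) hr, cfc_mul (fun t : ℝ => δ • (t + δ)⁻¹) (fun t : ℝ => t) a hr
      (by fun_prop), cfc_id' ℝ a, cfc_smul _ _ _ (continuousOn_resolventPos ha hδ)]
    rfl
  rw [e]
  refine norm_cfc_le hδ.le fun t ht => ?_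
  have ht0 := spectrum_nonneg_of_mem ha ht
  rw [Real.norm_of_nonneg (by simp only [smul_eq_mul]; positivity), smul_eq_mul]
  have h1 : δ * (t + δ)⁻¹ ≤ 1 := by
    rw [← div_eq_mul_inv, div_le_one (by positivity)]; linarith
  have h2 : t * (t + δ)⁻¹ ≤ 1 := by
    rw [← div_eq_mul_inv, div_le_one (by positivity)]; linarith
  calc δ * (t + δ)⁻¹ * t * (δ * (t + δ)⁻¹) = δ * ((δ * (t + δ)⁻¹) * (t * (t + δ)⁻¹)) := by ring
    _ ≤ δ * (1 * 1) := by gcongr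
    _ = δ := by ring

omit [PartialOrder B] [StarOrderedRing B] in
lemma star_resolventPos (δ : ℝ) (a : B) : star (resolventPos δ a) = resolventPos δ a :=
  (cfc_predicate (p := IsSelfAdjoint) (fun t : ℝ => (t + δ)⁻¹) a).star_eq

/-- If `x*x ≤ C b`, then `x` lies in the closed left ideal generated by `b`. -/
lemma mem_closedLeftIdeal_of_star_mul_le {x b : B} (hb : 0 ≤ b) {C : ℝ}
    (h : star x * x ≤ C • b) : x ∈ closedLeftIdeal b := by
  rw [mem_closedLeftIdeal_iff]
  intro ε hε
  set δ : ℝ := ε ^ 2 / (2 * (|C| + 1)) with hδdef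
  have hδ : 0 < δ := by positivity
  refine ⟨x * resolventPos δ b, ?_⟩
  set r := δ • resolventPos δ b with hr
  have hrs : star r = r := by rw [hr, star_smul, star_resolventPos]; simp
  have e : x - x * resolventPos δ b * b = x * r := by
    rw [mul_assoc, ← softSupport_eq_mul' hb hδ, softSupport_eq_one_sub hb hδ, mul_sub, mul_one,
      sub_sub_cancel]
  have h1 : ‖x * r‖ * ‖x * r‖ ≤ |C| * δ := by
    rw [← CStarRing.norm_star_mul_self]
    have h2 : star (x * r) * (x * r) ≤ C • (r * b * r) := by
      have := star_left_conjugate_le_conjugate h r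
      rw [star_mul]
      calc _ = star r * (star x * x) * r := by noncomm_ring
        _ ≤ _ := this
        _ = _ := by rw [hrs]; simp
    refine (CStarAlgebra.norm_le_norm_of_nonneg_of_le (star_mul_self_nonneg _) h2).trans ?_
    rw [norm_smul, Real.norm_eq_abs]
    gcongr
    exact norm_mul_resolventPos_mul_resolventPos_le hb hδ
  have h2 : |C| * δ < ε ^ 2 := by
    rw [hδdef, mul_div_assoc', div_lt_iff₀ (by positivity)]
    nlinarith [abs_nonneg C, pow_pos hε 2]
  rw [e]
  nlinarith [norm_nonneg (x * r)]

lemma sqrt_mem_closedLeftIdeal_of_le {a b : B} (ha : 0 ≤ a) (hb : 0 ≤ b) {C : ℝ}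
    (h : a ≤ C • b) : CFC.sqrt a ∈ closedLeftIdeal b := by
  apply mem_closedLeftIdeal_of_star_mul_le hb (C := C)
  rwa [star_sqrt, CFC.sqrt_mul_sqrt_self a ha]

lemma mem_closedLeftIdeal_of_le {a b : B} (ha : 0 ≤ a) (hb : 0 ≤ b) {C : ℝ}
    (h : a ≤ C • b) : a ∈ closedLeftIdeal b := by
  rw [← CFC.sqrt_mul_sqrt_self a ha]
  exact Ideal.mul_mem_left _ _ (sqrt_mem_closedLeftIdeal_of_le ha hb h)

lemma sqrt_mem_closedLeftIdeal {a b : B} (ha : 0 ≤ a) (h : a ∈ closedLeftIdeal b) :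
    CFC.sqrt a ∈ closedLeftIdeal b :=
  closedLeftIdeal_le h (sqrt_mem_closedLeftIdeal_of_le ha ha (C := 1) (by simp))

/-- If `x ∈ closedLeftIdeal b`, then `xx* ≾ b`. -/
lemma cuntzLE_mul_star_of_mem {x b : B} (hb : 0 ≤ b) (h : x ∈ closedLeftIdeal b) :
    CuntzLE (x * star x) b := by
  obtain ⟨y, hy⟩ : ∃ y : ℕ → B, Tendsto (fun n => y n * b) atTop (𝓝 x) := by
    choose y hy using fun n : ℕ => mem_closedLeftIdeal_iff.1 h (1 / ((n : ℝ) + 1)) (by positivity)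
    refine ⟨y, tendsto_iff_norm_sub_tendsto_zero.2 ?_⟩
    refine squeeze_zero (fun _ => norm_nonneg _) (fun n => ?_)
      tendsto_one_div_add_atTop_nhds_zero_nat
    rw [norm_sub_rev]
    exact (hy n).le
  refine ⟨fun n => y n * CFC.sqrt b, ?_⟩
  rw [← tendsto_iff_norm_sub_tendsto_zero]
  have hs := CFC.sqrt_mul_sqrt_self b hb
  have := hy.mul hy.star
  refine this.congr fun n => ?_
  have hbs : star b = b := (IsSelfAdjoint.of_nonneg hb).star_eq
  rw [star_mul, star_mul, star_sqrt, hbs]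
  calc y n * b * (b * star (y n))
      = y n * b * (CFC.sqrt b * CFC.sqrt b * star (y n)) := by rw [hs]
    _ = y n * (CFC.sqrt b * CFC.sqrt b) * (CFC.sqrt b * CFC.sqrt b * star (y n)) := by rw [hs]
    _ = y n * CFC.sqrt b * (CFC.sqrt b * CFC.sqrt b) * (CFC.sqrt b * star (y n)) := by noncomm_ring
    _ = _ := by rw [hs]

lemma cuntzLE_of_mem {a b : B} (ha : 0 ≤ a) (hb : 0 ≤ b) (h : a ∈ closedLeftIdeal b) :
    CuntzLE a b := by
  have := cuntzLE_mul_star_of_mem hb (sqrt_mem_closedLeftIdeal ha h)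
  rwa [star_sqrt, CFC.sqrt_mul_sqrt_self a ha] at this

lemma cuntzLE_of_le {a b : B} (ha : 0 ≤ a) (hb : 0 ≤ b) {C : ℝ} (h : a ≤ C • b) : CuntzLE a b :=
  cuntzLE_of_mem ha hb (mem_closedLeftIdeal_of_le ha hb h)

lemma mem_closedLeftIdeal_mul_self {b : B} (hb : 0 ≤ b) : b ∈ closedLeftIdeal (b * b) := by
  have hbs : star b = b := (IsSelfAdjoint.of_nonneg hb).star_eq
  refine mem_closedLeftIdeal_of_star_mul_le (C := 1) ?_ ?_
  · simpa [hbs] using star_mul_self_nonneg b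
  · rw [hbs, one_smul]

lemma cuntzLE_mul_star_star_mul (x : B) : CuntzLE (x * star x) (star x * x) := by
  have h0 := mul_star_self_nonneg x
  have h1 : CuntzLE (x * star x) ((x * star x) * (x * star x)) :=
    cuntzLE_of_mem h0 (by
      have := star_mul_self_nonneg (x * star x)
      rwa [(IsSelfAdjoint.of_nonneg h0).star_eq] at this) (mem_closedLeftIdeal_mul_self h0)
  refine h1.trans ⟨fun _ => x, ?_⟩
  have : x * (star x * x) * star x - x * star x * (x * star x) = 0 := by noncomm_ring
  simp [this]

lemma cuntzEquiv_mul_star_star_mul (x : B) : CuntzEquiv (x * star x) (star x * x) := by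
  refine ⟨cuntzLE_mul_star_star_mul x, ?_⟩
  simpa using cuntzLE_mul_star_star_mul (star x)

end CuntzBasics

section Projections

variable {B : Type*} [CStarAlgebra B]

lemma isProjection_one_sub {p : B} (hp : IsProjection p) : IsProjection (1 - p) := by
  refine ⟨by rw [star_sub, star_one, hp.1], ?_⟩
  rw [mul_sub, sub_mul, sub_mul, one_mul, one_mul, mul_one, hp.2, sub_self, sub_zero]

lemma norm_isProjection_le_one {p : B} (hp : IsProjection p) : ‖p‖ ≤ 1 :=
  IsStarProjection.norm_le p ⟨hp.2, hp.1⟩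

lemma isProjection_mul_star {w p : B} (hp : IsProjection p) (hw : star w * w = p) :
    IsProjection (w * star w) ∧ w * p = w := by
  have h : w * p = w := by
    have h2 : star (w * p - w) * (w * p - w) = 0 := by
      rw [star_sub, star_mul, hp.1]
      calc (p * star w - star w) * (w * p - w)
          = p * (star w * w) * p - p * (star w * w) - (star w * w) * p + star w * w := by
            noncomm_ring
        _ = 0 := by rw [hw, hp.2, hp.2]; abel
    exact sub_eq_zero.1 ((CStarRing.star_mul_self_eq_zero_iff _).1 h2)
  refine ⟨⟨by rw [star_mul, star_star], ?_⟩, h⟩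
  calc w * star w * (w * star w) = w * (star w * w) * star w := by noncomm_ring
    _ = _ := by rw [hw, h]

variable [PartialOrder B] [StarOrderedRing B]

lemma IsProjection.nonneg {p : B} (hp : IsProjection p) : 0 ≤ p := by
  have := star_mul_self_nonneg p
  rwa [hp.1, hp.2] at this

/-- If `p` is a projection and `p x*x p ≥ δ p`, then the polar part of `x p` is a partial isometry
with source `p`, whose range projection supports `x p`. -/
lemma exists_partial_isometry {x p : B} (hp : IsProjection p) {δ : ℝ} (hδ : 0 < δ)
    (h : δ • p ≤ p * (star x * x) * p) :
    ∃ w c : B, w = x * c ∧ star w * w = p ∧ (1 - w * star w) * (x * p) = 0 := by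
  obtain ⟨hps, hpp⟩ := hp
  set z : B := p * (star x * x) * p + (1 - p) with hz
  have hq := isProjection_one_sub ⟨hps, hpp⟩
  have hzlb : algebraMap ℝ B (min δ 1) ≤ z := by
    have h1 : min δ 1 • p ≤ p * (star x * x) * p :=
      (smul_le_smul_of_nonneg_right (min_le_left _ _) (IsProjection.nonneg ⟨hps, hpp⟩)).trans h
    have h2 : min δ 1 • (1 - p) ≤ 1 - p := by
      have := smul_le_smul_of_nonneg_right (min_le_right δ 1) hq.nonneg
      rwa [one_smul] at this
    calc algebraMap ℝ B (min δ 1) = min δ 1 • p + min δ 1 • (1 - p) := by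
          rw [Algebra.algebraMap_eq_smul_one, ← smul_add, add_sub_cancel]
      _ ≤ z := add_le_add h1 h2
  have hmin : 0 < min δ 1 := lt_min hδ one_pos
  have hzpos : IsStrictlyPositive z := by
    refine IsStrictlyPositive.of_le ⟨algebraMap_nonneg B hmin.le, ?_⟩ hzlb
    exact (IsUnit.mk0 _ hmin.ne').map (algebraMap ℝ B)
  have hpz : p * z = p * (star x * x) * p := by
    rw [hz, mul_add, mul_sub, hpp, mul_one, sub_self, add_zero]
    simp only [← mul_assoc, hpp]
  have hzp : z * p = p * (star x * x) * p := by
    rw [hz, add_mul, sub_mul, hpp, one_mul, sub_self, add_zero, mul_assoc, hpp]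
  have hcomm : Commute z p := hzp.trans hpz.symm
  set r : B := z ^ (-(1 / 2) : ℝ) with hr
  have hrs : star r = r := (IsSelfAdjoint.of_nonneg CFC.rpow_nonneg).star_eq
  have hrp : Commute r p := by
    rw [hr, CFC.rpow_def]
    exact hcomm.cfc_nnreal _
  have hrz : Commute r z := by
    rw [hr, CFC.rpow_def]
    exact (Commute.refl z).cfc_nnreal _
  have hrzr : r * z * r = 1 := CFC.conjugate_rpow_neg_one_half z
  have key : star (x * p * r) * (x * p * r) = p := by
    rw [star_mul, star_mul, hrs, hps]
    calc r * (p * star x) * (x * p * r) = r * (p * (star x * x) * p) * r := by noncomm_ring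
      _ = r * (z * p) * r := by rw [hzp]
      _ = r * z * (p * r) := by noncomm_ring
      _ = r * z * r * p := by rw [← hrp.eq]; noncomm_ring
      _ = p := by rw [hrzr, one_mul]
  refine ⟨x * p * r, p * r, by noncomm_ring, key, ?_⟩
  rw [sub_mul, one_mul, sub_eq_zero, star_mul, star_mul, hrs, hps]
  symm
  calc x * p * r * (r * (p * star x)) * (x * p)
      = x * p * r * r * (p * (star x * x) * p) := by noncomm_ring
    _ = x * p * (r * (r * z)) * p := by rw [← hzp]; noncomm_ring
    _ = x * p := by rw [hrz.eq, ← mul_assoc r, hrzr, mul_one, mul_assoc, hpp]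

lemma le_algebraMap_of_norm_le {a : B} (ha : IsSelfAdjoint a) {r : ℝ} (h : ‖a‖ ≤ r) :
    a ≤ algebraMap ℝ B r :=
  ha.le_algebraMap_norm_self.trans (algebraMap_mono B h)

omit [PartialOrder B] [StarOrderedRing B] in
lemma conjugate_algebraMap_of_isProjection {p : B} (hp : IsProjection p) (r : ℝ) :
    p * algebraMap ℝ B r * p = r • p := by
  rw [← Algebra.commutes, mul_assoc, hp.2, Algebra.smul_def]

lemma conjugate_mono_of_isProjection {p a b : B} (hp : IsProjection p) (h : a ≤ b) :
    p * a * p ≤ p * b * p := by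
  have := star_left_conjugate_le_conjugate h p
  rwa [hp.1] at this

/-- A projection Cuntz below `H` is implemented by a partial isometry with range in the hereditary
subalgebra generated by `H`. -/
lemma exists_partial_isometry_of_cuntzLE {p H : B} (hp : IsProjection p) (hH : 0 ≤ H)
    (h : CuntzLE p H) : ∃ w c : B, w = CFC.sqrt H * c ∧ star w * w = p := by
  obtain ⟨v, hv⟩ := cuntzLE_iff.1 h (1 / 2) (by norm_num)
  set x := CFC.sqrt H * star v with hx
  have hxx : star x * x = v * H * star v := by
    rw [hx, star_mul, star_star, star_sqrt]
    calc v * CFC.sqrt H * (CFC.sqrt H * star v)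
        = v * (CFC.sqrt H * CFC.sqrt H) * star v := by noncomm_ring
      _ = _ := by rw [CFC.sqrt_mul_sqrt_self H hH]
  have hle : (1 / 2 : ℝ) • p ≤ p * (star x * x) * p := by
    have hsa : IsSelfAdjoint (p - star x * x) :=
      IsSelfAdjoint.sub (show IsSelfAdjoint p from hp.1) (IsSelfAdjoint.star_mul_self x)
    have h1 : p - star x * x ≤ algebraMap ℝ B (1 / 2) := by
      refine le_algebraMap_of_norm_le hsa ?_
      rw [hxx, norm_sub_rev]
      exact hv.le
    have h2 := conjugate_mono_of_isProjection hp h1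
    rw [conjugate_algebraMap_of_isProjection hp, mul_sub, sub_mul, hp.2, hp.2,
      sub_le_iff_le_add] at h2
    have h3 : p = (1 / 2 : ℝ) • p + (1 / 2 : ℝ) • p := by
      rw [← add_smul]; norm_num
    calc (1 / 2 : ℝ) • p = p - (1 / 2 : ℝ) • p := by rw [eq_sub_iff_add_eq, ← h3]
      _ ≤ _ := sub_le_iff_le_add'.2 h2
  obtain ⟨w, c, hw, hww, -⟩ := exists_partial_isometry hp (by norm_num) hle
  exact ⟨w, star v * c, by rw [hw, hx, mul_assoc], hww⟩

/-- In real rank zero algebras, hereditary subalgebras have large projections. -/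
lemma RealRankZero.exists_projection (hRR : RealRankZero B) {a : B} (ha : 0 ≤ a) {ε : ℝ}
    (hε : 0 < ε) :
    ∃ q : B, IsProjection q ∧ q ∈ closedLeftIdeal a ∧ ‖(1 - q) * a * (1 - q)‖ ≤ ε := by
  have hδ : 0 < ε / 3 := by positivity
  set δ := ε / 3 with hδdef
  obtain ⟨b, hb, hfin, hab⟩ := hRR a (IsSelfAdjoint.of_nonneg ha) δ hδ
  have hfinR : (spectrum ℝ b).Finite := by
    rw [← spectrum.preimage_algebraMap ℂ]
    exact hfin.preimage (Complex.ofReal_injective.injOn)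
  have hcont : ∀ f : ℝ → ℝ, ContinuousOn f (spectrum ℝ b) := fun f => hfinR.continuousOn f
  set χ : ℝ → ℝ := fun t => if 2 * δ ≤ t then 1 else 0 with hχ
  set e : B := cfc χ b with he
  have hep : IsProjection e := by
    refine ⟨(cfc_predicate (p := IsSelfAdjoint) χ b).star_eq, ?_⟩
    rw [he, ← cfc_mul χ χ b (hcont _) (hcont _)]
    congr 1
    ext t
    simp [hχ]
  have hbe : e * b * e = cfc (fun t => χ t * t * χ t) b := by
    rw [cfc_mul (fun t => χ t * t) χ b (hcont _) (hcont _),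
      cfc_mul χ (fun t => t) b (hcont _) (hcont _), cfc_id' ℝ b]
  have he' : 1 - e = cfc (fun t => 1 - χ t) b := by
    rw [cfc_sub (fun _ => (1 : ℝ)) χ b (hcont _) (hcont _), cfc_const_one ℝ b]
  have hbe' : (1 - e) * b * (1 - e) = cfc (fun t => (1 - χ t) * t * (1 - χ t)) b := by
    rw [cfc_mul (fun t => (1 - χ t) * t) (fun t => 1 - χ t) b (hcont _) (hcont _),
      cfc_mul (fun t => 1 - χ t) (fun t => t) b (hcont _) (hcont _), cfc_id' ℝ b, he']
  have hlow : (2 * δ) • e ≤ e * b * e := by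
    rw [hbe, he, ← cfc_smul _ _ _ (hcont _)]
    refine cfc_mono (fun t _ => ?_) (hcont _) (hcont _)
    by_cases h : 2 * δ ≤ t <;> simp [hχ, h]
  have hup : (1 - e) * b * (1 - e) ≤ algebraMap ℝ B (2 * δ) := by
    rw [hbe']
    refine cfc_le_algebraMap _ _ _ (fun t _ => ?_) (hcont _)
    by_cases h : 2 * δ ≤ t
    · simp [hχ, h, hδ.le]
    · simp [hχ, h]; linarith
  have hsa : IsSelfAdjoint (a - b) := (IsSelfAdjoint.of_nonneg ha).sub hb
  have hab1 : a ≤ b + algebraMap ℝ B δ := by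
    rw [← sub_le_iff_le_add']
    exact le_algebraMap_of_norm_le hsa hab.le
  have hab2 : b ≤ a + algebraMap ℝ B δ := by
    rw [← sub_le_iff_le_add']
    have h := le_algebraMap_of_norm_le hsa.neg (r := δ) (by rw [norm_neg]; exact hab.le)
    rwa [neg_sub] at h
  have he1 := isProjection_one_sub hep
  have hae' : (1 - e) * a * (1 - e) ≤ algebraMap ℝ B ε := by
    have h1 := conjugate_mono_of_isProjection he1 hab1
    rw [mul_add, add_mul, conjugate_algebraMap_of_isProjection he1] at h1
    have h2 : δ • (1 - e) ≤ algebraMap ℝ B δ := by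
      rw [Algebra.algebraMap_eq_smul_one]
      exact smul_le_smul_of_nonneg_left (sub_le_self _ hep.nonneg) hδ.le
    calc _ ≤ _ := h1
      _ ≤ algebraMap ℝ B (2 * δ) + algebraMap ℝ B δ := add_le_add hup h2
      _ = algebraMap ℝ B ε := by rw [← map_add]; congr 1; rw [hδdef]; ring
  have hs := CFC.sqrt_mul_sqrt_self a ha
  have hae : δ • e ≤ e * (star (CFC.sqrt a) * CFC.sqrt a) * e := by
    rw [star_sqrt, hs]
    have h1 := conjugate_mono_of_isProjection hep hab2
    rw [mul_add, add_mul, conjugate_algebraMap_of_isProjection hep] at h1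
    have h2 := hlow.trans h1
    have h3 : (2 * δ) • e = δ • e + δ • e := by rw [← add_smul]; ring_nf
    rw [h3] at h2
    exact le_of_add_le_add_right h2
  obtain ⟨w, c, hw, hww, hwx⟩ := exists_partial_isometry hep hδ hae
  have hq := (isProjection_mul_star hep hww).1
  refine ⟨w * star w, hq, ?_, ?_⟩
  · have : w * star w = (w * star c) * CFC.sqrt a := by
      nth_rewrite 2 [hw]
      rw [star_mul, star_sqrt, mul_assoc]
    rw [this]
    exact Ideal.mul_mem_left _ _
      (sqrt_mem_closedLeftIdeal ha (self_mem_closedLeftIdeal a))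
  · set q := w * star w with hqdef
    have hq1 := isProjection_one_sub hq
    have h1 : (1 - q) * CFC.sqrt a = (1 - q) * (CFC.sqrt a * (1 - e)) := by
      rw [mul_sub, mul_sub, hwx, mul_one, sub_zero]
    have h2 : (1 - q) * a * (1 - q)
        = ((1 - q) * (CFC.sqrt a * (1 - e))) * star ((1 - q) * (CFC.sqrt a * (1 - e))) := by
      rw [← h1, star_mul, star_sqrt, hq1.1]
      calc _ = (1 - q) * (CFC.sqrt a * CFC.sqrt a) * (1 - q) := by rw [hs]
        _ = _ := by noncomm_ring
    rw [h2, CStarRing.norm_self_mul_star]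
    have h3 : ‖(1 - q) * (CFC.sqrt a * (1 - e))‖ ≤ ‖CFC.sqrt a * (1 - e)‖ :=
      (norm_mul_le _ _).trans (mul_le_of_le_one_left (norm_nonneg _)
        (norm_isProjection_le_one hq1))
    have h4 : ‖CFC.sqrt a * (1 - e)‖ * ‖CFC.sqrt a * (1 - e)‖ ≤ ε := by
      rw [← CStarRing.norm_star_mul_self, star_mul, star_sqrt, he1.1]
      have h5 : (1 - e) * CFC.sqrt a * (CFC.sqrt a * (1 - e)) = (1 - e) * a * (1 - e) := by
        nth_rewrite 3 [← hs]
        noncomm_ring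
      rw [h5]
      refine (CStarAlgebra.norm_le_iff_le_algebraMap _ hε.le ?_).2 hae'
      have := star_left_conjugate_nonneg ha (1 - e)
      rwa [he1.1] at this
    calc _ ≤ ‖CFC.sqrt a * (1 - e)‖ * ‖CFC.sqrt a * (1 - e)‖ := by gcongr
      _ ≤ ε := h4

end Projections

section ContinuousMaps

variable {A : Type*} [CStarAlgebra A] [PartialOrder A] [StarOrderedRing A]
variable {Y : Type*} [TopologicalSpace Y] [CompactSpace Y]

instance continuousMapStarOrderedRing : StarOrderedRing C(Y, A) := by
  refine StarOrderedRing.of_nonneg_iff' (fun {f g} hfg h y => ?_) fun f => ⟨fun hf => ?_, ?_⟩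
  · exact add_le_add_right (hfg y) (h y)
  · have hf' : ∀ y, 0 ≤ f y := fun y => hf y
    have hc : Continuous fun y => cfc Real.sqrt (f y) :=
      Continuous.cfc_of_mem_nhdsSet (s := Set.univ) Real.sqrt (by simp) f.continuous
        (fun y => IsSelfAdjoint.of_nonneg (hf' y)) Real.continuous_sqrt.continuousOn
    refine ⟨⟨_, hc⟩, ?_⟩
    ext y
    have hs : star (cfc Real.sqrt (f y)) = cfc Real.sqrt (f y) :=
      (cfc_predicate (p := IsSelfAdjoint) Real.sqrt (f y)).star_eq
    simp only [ContinuousMap.mul_apply, ContinuousMap.star_apply, ContinuousMap.coe_mk]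
    rw [hs, ← cfc_mul Real.sqrt Real.sqrt (f y) Real.continuous_sqrt.continuousOn
      Real.continuous_sqrt.continuousOn]
    have : cfc (fun t : ℝ => Real.sqrt t * Real.sqrt t) (f y) = cfc (fun t : ℝ => t) (f y) :=
      cfc_congr fun t ht => Real.mul_self_sqrt (spectrum_nonneg_of_mem (hf' y) ht)
    rw [this, cfc_id' ℝ (f y) (IsSelfAdjoint.of_nonneg (hf' y))]
  · rintro ⟨s, rfl⟩ y
    exact star_mul_self_nonneg (s y)

omit [PartialOrder A] [StarOrderedRing A] [CompactSpace Y] in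
lemma algebraMap_continuousMap_apply (r : ℝ) (y : Y) :
    algebraMap ℝ C(Y, A) r y = algebraMap ℝ A r := rfl

lemma softSupport_apply {f : C(Y, A)} (hf : 0 ≤ f) {δ : ℝ} (hδ : 0 < δ) (y : Y) :
    softSupport δ f y = softSupport δ (f y) := by
  have h := congrArg (fun g : C(Y, A) => g y) (add_mul_resolventPos hf hδ)
  have h2 : resolventPos δ (f y) = resolventPos δ f y :=
    resolventPos_eq_of_mul_eq_one (hf y) hδ h
  have h3 : softSupport δ (f y) = f y * resolventPos δ (f y) := softSupport_eq_mul (hf y) hδ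
  rw [softSupport_eq_mul hf hδ, h3, h2]
  rfl

omit [PartialOrder A] [StarOrderedRing A] in
lemma apply_mem_closedLeftIdeal {f g : C(Y, A)} (h : f ∈ closedLeftIdeal g) (y : Y) :
    f y ∈ closedLeftIdeal (g y) := by
  rw [mem_closedLeftIdeal_iff] at *
  intro ε hε
  obtain ⟨k, hk⟩ := h ε hε
  exact ⟨k y, ((f - k * g).norm_coe_le_norm y).trans_lt hk⟩

omit [StarOrderedRing A] [CompactSpace Y] in
lemma const_nonneg {a : A} (ha : 0 ≤ a) : 0 ≤ ContinuousMap.const Y a := fun _ => ha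

omit [PartialOrder A] [StarOrderedRing A] [CompactSpace Y] in
lemma IsProjection.const {p : A} (hp : IsProjection p) :
    IsProjection (ContinuousMap.const Y p) := by
  constructor <;> ext y
  · exact hp.1
  · exact hp.2

end ContinuousMaps

section Traces

variable {B : Type*} [CStarAlgebra B] [PartialOrder B] [StarOrderedRing B]

/-- The real part of a trace. -/
def IsTracialState.toLinearMap {τ : B → ℂ} (hτ : IsTracialState τ) : B →ₗ[ℝ] ℝ where
  toFun x := (τ x).re
  map_add' x y := by rw [hτ.1, Complex.add_re]
  map_smul' c x := by
    have : c • x = (c : ℂ) • x := by rw [Complex.coe_smul]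
    rw [this, hτ.2.1, Complex.re_ofReal_mul]
    rfl

omit [StarOrderedRing B] in
lemma IsTracialState.toLinearMap_mul_comm {τ : B → ℂ} (hτ : IsTracialState τ) (x y : B) :
    hτ.toLinearMap (x * y) = hτ.toLinearMap (y * x) :=
  congrArg Complex.re (hτ.2.2.2.2 x y)

omit [StarOrderedRing B] in
lemma IsTracialState.toLinearMap_one {τ : B → ℂ} (hτ : IsTracialState τ) :
    hτ.toLinearMap 1 = 1 := by
  change (τ 1).re = 1
  rw [hτ.2.2.1, Complex.one_re]

lemma IsTracialState.toLinearMap_mono {τ : B → ℂ} (hτ : IsTracialState τ) {x y : B} (h : x ≤ y) :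
    hτ.toLinearMap x ≤ hτ.toLinearMap y := by
  rw [← sub_nonneg, ← map_sub]
  exact (hτ.2.2.2.1 _ (sub_nonneg.2 h)).1

omit [StarOrderedRing B] in
lemma IsTracialState.toLinearMap_algebraMap {τ : B → ℂ} (hτ : IsTracialState τ) (r : ℝ) :
    hτ.toLinearMap (algebraMap ℝ B r) = r := by
  rw [Algebra.algebraMap_eq_smul_one, map_smul, hτ.toLinearMap_one, smul_eq_mul, mul_one]

lemma continuousOn_rpow_inv_nat (n : ℕ) (s : Set ℝ) :
    ContinuousOn (fun t : ℝ => t ^ (n : ℝ)⁻¹) s :=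
  (Real.continuous_rpow_const (by positivity)).continuousOn

omit [StarOrderedRing B] in
lemma IsTracialState.dTr_eq_of_isProjection {τ : B → ℂ} (hτ : IsTracialState τ) {p : B}
    (hp : IsProjection p) : dTr τ p = hτ.toLinearMap p := by
  refine Tendsto.limUnder_eq (tendsto_const_nhds.congr' ?_)
  filter_upwards [eventually_gt_atTop 0] with n hn
  have hsp : spectrum ℝ p ⊆ {0, 1} := by
    have : IsIdempotentElem p := hp.2
    exact this.spectrum_subset ℝ
  have : cfc (fun t : ℝ => t ^ (n : ℝ)⁻¹) p = cfc (fun t : ℝ => t) p := by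
    refine cfc_congr fun t ht => ?_
    have hn' : (n : ℝ)⁻¹ ≠ 0 := by positivity
    rcases hsp ht with rfl | rfl
    · exact Real.zero_rpow hn'
    · exact Real.one_rpow _
  rw [this, cfc_id' ℝ p (show IsSelfAdjoint p from hp.1)]
  rfl

/-- The limit defining the dimension function dominates the trace of every soft support. -/
lemma IsTracialState.softSupport_le_dTr {τ : B → ℂ} (hτ : IsTracialState τ) {a : B} (ha : 0 ≤ a)
    {δ : ℝ} (hδ : 0 < δ) : hτ.toLinearMap (softSupport δ a) ≤ dTr τ a := by
  set T := hτ.toLinearMap with hT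
  set M : ℝ := max ‖a‖ 1 with hM
  have hM1 : 1 ≤ M := le_max_right _ _
  have hM0 : 0 < M := by linarith
  have hsp : ∀ t ∈ spectrum ℝ a, 0 ≤ t ∧ t ≤ M := by
    intro t ht
    rcases subsingleton_or_nontrivial B with hB | hB
    · simp at ht
    · exact ⟨spectrum_nonneg_of_mem ha ht, (le_abs_self t).trans
        ((spectrum.norm_le_norm_of_mem ht).trans (le_max_left _ _))⟩
  set u : ℕ → ℝ := fun n => T (cfc (fun t : ℝ => t ^ (n : ℝ)⁻¹) a) with hu
  set w : ℕ → ℝ := fun n => T (cfc (fun t : ℝ => (t / M) ^ (n : ℝ)⁻¹) a) with hw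
  have hcw : ∀ n : ℕ, ContinuousOn (fun t : ℝ => (t / M) ^ (n : ℝ)⁻¹) (spectrum ℝ a) := fun n =>
    ((Real.continuous_rpow_const (by positivity)).comp (continuous_id.div_const M)).continuousOn
  have huw : ∀ n : ℕ, u n = M ^ (n : ℝ)⁻¹ * w n := by
    intro n
    simp only [hu, hw]
    rw [← smul_eq_mul, ← map_smul, ← cfc_smul _ _ _ (hcw n)]
    congr 1
    refine cfc_congr fun t ht => ?_
    have ht' := (hsp t ht).1
    simp only [smul_eq_mul]
    rw [← Real.mul_rpow hM0.le (by positivity), mul_div_cancel₀ _ hM0.ne']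
  have hmono : Monotone fun k => w (k + 1) := by
    refine monotone_nat_of_le_succ fun k => hτ.toLinearMap_mono ?_
    refine cfc_mono (fun t ht => ?_) (hcw _) (hcw _)
    have ht' := hsp t ht
    refine Real.rpow_le_rpow_of_exponent_ge_of_imp (div_nonneg ht'.1 hM0.le)
      ((div_le_one hM0).2 ht'.2) ?_ ?_
    · gcongr
      simp
    · intro _ h
      exfalso
      have : (0 : ℝ) < ((k + 1 : ℕ) : ℝ)⁻¹ := by positivity
      linarith
  have hbdd : BddAbove (Set.range fun k => w (k + 1)) := by
    refine ⟨1, ?_⟩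
    rintro _ ⟨k, rfl⟩
    rw [← hτ.toLinearMap_one]
    refine hτ.toLinearMap_mono (cfc_le_one _ _ fun t ht => ?_)
    have ht' := hsp t ht
    exact Real.rpow_le_one (div_nonneg ht'.1 hM0.le) ((div_le_one hM0).2 ht'.2) (by positivity)
  have hinv : Tendsto (fun n : ℕ => ((n : ℝ))⁻¹) atTop (𝓝 0) := tendsto_inv_atTop_nhds_zero_nat
  have hroot : ∀ c : ℝ, 0 < c → Tendsto (fun n : ℕ => c ^ (n : ℝ)⁻¹) atTop (𝓝 1) := by
    intro c hc
    have := (Real.continuousAt_const_rpow (a := c) (b := 0) hc.ne').tendsto.comp hinv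
    rwa [Real.rpow_zero] at this
  obtain ⟨l, hl⟩ : ∃ l, Tendsto u atTop (𝓝 l) := by
    have h1 := (tendsto_add_atTop_iff_nat 1).1 (tendsto_atTop_ciSup hmono hbdd)
    refine ⟨_, ((hroot M hM0).mul h1).congr fun n => (huw n).symm⟩
  have hd : dTr τ a = l := Tendsto.limUnder_eq hl
  rw [hd]
  refine le_of_forall_pos_le_add fun η hη => ?_
  refine ge_of_tendsto (hl.add_const η) ?_
  have hc : 0 < min (η * δ) 1 := by positivity
  filter_upwards [(hroot _ hc).eventually (lt_mem_nhds (show 1 - η < 1 by linarith)),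
    eventually_gt_atTop 0] with n hn hn0
  rw [← hτ.toLinearMap_algebraMap η]
  simp only [hu]
  rw [← hT, ← map_add, ← cfc_add_const _ _ _ (continuousOn_rpow_inv_nat n _)]
  refine hτ.toLinearMap_mono (cfc_mono (fun t ht => ?_) (continuousOn_softSupport ha hδ)
    ((continuousOn_rpow_inv_nat n _).add continuousOn_const))
  have ht' := hsp t ht
  rcases le_total t (η * δ) with h | h
  · have h1 : t / (t + δ) ≤ η := by
      rw [div_le_iff₀ (by linarith)]
      nlinarith [mul_nonneg hη.le ht'.1]
    have h2 : 0 ≤ t ^ (n : ℝ)⁻¹ := Real.rpow_nonneg ht'.1 _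
    linarith
  · have h1 : t / (t + δ) ≤ 1 := by
      rw [div_le_one (by linarith)]
      linarith
    have h2 : (min (η * δ) 1) ^ (n : ℝ)⁻¹ ≤ t ^ (n : ℝ)⁻¹ :=
      Real.rpow_le_rpow hc.le ((min_le_left _ _).trans h) (by positivity)
    linarith

end Traces

section SoftSupportOfSums

variable {B : Type*} [CStarAlgebra B] [PartialOrder B] [StarOrderedRing B]

lemma softSupport_add_of_mul_eq_zero {x y : B} (hx : 0 ≤ x) (hy : 0 ≤ y) (hxy : x * y = 0)
    {δ : ℝ} (hδ : 0 < δ) : softSupport δ (x + y) = softSupport δ x + softSupport δ y := by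
  have hyx : y * x = 0 := by
    have h := congrArg star hxy
    rwa [star_mul, star_zero, (IsSelfAdjoint.of_nonneg hx).star_eq,
      (IsSelfAdjoint.of_nonneg hy).star_eq] at h
  have key : ∀ {u v : B}, 0 ≤ u → v * u = 0 → v * resolventPos δ u = δ⁻¹ • v := by
    intro u v hu hvu
    have h1 : v * ((u + algebraMap ℝ B δ) * resolventPos δ u) = δ • (v * resolventPos δ u) := by
      rw [← mul_assoc, mul_add, hvu, zero_add, ← Algebra.commutes, mul_assoc, ← Algebra.smul_def]
    rw [add_mul_resolventPos hu hδ, mul_one] at h1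
    nth_rewrite 2 [h1]
    rw [smul_smul, inv_mul_cancel₀ hδ.ne', one_smul]
  have hr := add_mul_resolventPos hx hδ
  have hs := add_mul_resolventPos hy hδ
  have h1 := key hx hyx
  have h2 := key hy hxy
  have hinv : (x + y + algebraMap ℝ B δ) * (resolventPos δ x + resolventPos δ y - δ⁻¹ • (1 : B))
      = 1 := by
    have e1 : (x + y + algebraMap ℝ B δ) * resolventPos δ x = 1 + δ⁻¹ • y := by
      rw [← hr, ← h1]; noncomm_ring
    have e2 : (x + y + algebraMap ℝ B δ) * resolventPos δ y = 1 + δ⁻¹ • x := by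
      rw [← hs, ← h2]; noncomm_ring
    have e3 : δ⁻¹ • algebraMap ℝ B δ = 1 := by
      rw [Algebra.algebraMap_eq_smul_one, smul_smul, inv_mul_cancel₀ hδ.ne', one_smul]
    rw [mul_sub, mul_add, e1, e2, mul_smul_comm, mul_one, smul_add, smul_add, e3]
    abel
  have h3 := resolventPos_eq_of_mul_eq_one (add_nonneg hx hy) hδ hinv
  rw [softSupport_eq_one_sub (add_nonneg hx hy) hδ, softSupport_eq_one_sub hx hδ,
    softSupport_eq_one_sub hy hδ, h3, smul_sub, smul_add, smul_smul, mul_inv_cancel₀ hδ.ne',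
    one_smul]
  abel

lemma softSupport_smul_isProjection {p : B} (hp : IsProjection p) {c δ : ℝ} (hc : 0 ≤ c)
    (hδ : 0 < δ) : softSupport δ (c • p) = (c / (c + δ)) • p := by
  have hcp : 0 ≤ c • p := smul_nonneg hc hp.nonneg
  have hcδ : c + δ ≠ 0 := by positivity
  have hinv : (c • p + algebraMap ℝ B δ) * (δ⁻¹ • (1 : B) - (c / (δ * (c + δ))) • p) = 1 := by
    have e : (c • p + algebraMap ℝ B δ) * (δ⁻¹ • (1 : B) - (c / (δ * (c + δ))) • p)
        = (δ * δ⁻¹) • (1 : B) +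
          (c * δ⁻¹ - c * (c / (δ * (c + δ))) - δ * (c / (δ * (c + δ)))) • p := by
      rw [Algebra.algebraMap_eq_smul_one, add_mul, mul_sub, mul_sub, smul_mul_smul_comm,
        smul_mul_smul_comm, smul_mul_smul_comm, smul_mul_smul_comm, hp.2, mul_one, mul_one,
        one_mul]
      module
    rw [e, mul_inv_cancel₀ hδ.ne', one_smul]
    have : c * δ⁻¹ - c * (c / (δ * (c + δ))) - δ * (c / (δ * (c + δ))) = 0 := by
      field_simp
      ring
    rw [this, zero_smul, add_zero]
  rw [softSupport_eq_one_sub hcp hδ, resolventPos_eq_of_mul_eq_one hcp hδ hinv, smul_sub,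
    smul_smul, smul_smul, mul_inv_cancel₀ hδ.ne', one_smul, sub_sub_cancel]
  congr 1
  field_simp

lemma softSupport_le_add_corner {H R : B} (hH : 0 ≤ H) (hR : IsProjection R) {δ : ℝ} (hδ : 0 < δ) :
    softSupport δ H ≤ R + softSupport (δ / 2) ((1 - R) * H * (1 - R)) := by
  have hR1 := isProjection_one_sub hR
  set K := (1 - R) * H * (1 - R) with hK
  have hK0 : 0 ≤ K := by
    have := star_left_conjugate_nonneg hH (1 - R)
    rwa [hR1.1] at this
  have hpos : 0 ≤ (R - (1 - R)) * H * (R - (1 - R)) := by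
    have := star_left_conjugate_nonneg hH (R - (1 - R))
    rwa [star_sub, hR.1, hR1.1] at this
  have h1 : R * H * R ≤ ‖H‖ • R := by
    have := conjugate_mono_of_isProjection hR (le_algebraMap_of_norm_le
      (IsSelfAdjoint.of_nonneg hH) le_rfl)
    rwa [conjugate_algebraMap_of_isProjection hR] at this
  have h2 : H ≤ (2 * ‖H‖) • R + (2 : ℝ) • K := by
    have e : H + (R - (1 - R)) * H * (R - (1 - R)) = (2 : ℝ) • (R * H * R) + (2 : ℝ) • K := by
      rw [hK, two_smul, two_smul]
      noncomm_ring
    calc H ≤ H + (R - (1 - R)) * H * (R - (1 - R)) := le_add_of_nonneg_right hpos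
      _ = (2 : ℝ) • (R * H * R) + (2 : ℝ) • K := e
      _ ≤ _ := by
        rw [mul_smul]
        gcongr
  have hRK : ((2 * ‖H‖) • R) * ((2 : ℝ) • K) = 0 := by
    have : R * K = 0 := by
      rw [hK, ← mul_assoc, ← mul_assoc, mul_sub R 1 R, hR.2, mul_one, sub_self, zero_mul, zero_mul]
    rw [smul_mul_smul_comm, this, smul_zero]
  have hc : 0 ≤ 2 * ‖H‖ := by positivity
  refine (softSupport_mono hH h2 hδ).trans ?_
  rw [softSupport_add_of_mul_eq_zero (smul_nonneg hc hR.nonneg) (smul_nonneg zero_le_two hK0) hRK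
    hδ, softSupport_smul hK0 two_pos hδ, softSupport_smul_isProjection hR hc hδ]
  refine add_le_add_left ?_ _
  have h3 : 2 * ‖H‖ / (2 * ‖H‖ + δ) ≤ 1 := by
    rw [div_le_one (by positivity)]
    linarith
  calc _ ≤ (1 : ℝ) • R := smul_le_smul_of_nonneg_right h3 hR.nonneg
    _ = R := one_smul _ _

end SoftSupportOfSums

section Faithful

variable {B : Type*} [CStarAlgebra B] [PartialOrder B] [StarOrderedRing B]

lemma star_mul_self_mul_le (x y : B) : star (x * y) * (x * y) ≤ ‖x‖ ^ 2 • (star y * y) := by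
  have h := CStarAlgebra.star_left_conjugate_le_norm_smul (a := y) (b := star x * x)
  rw [CStarRing.norm_star_mul_self, ← pow_two] at h
  rw [star_mul]
  calc _ = star y * (star x * x) * y := by noncomm_ring
    _ ≤ _ := h

lemma star_add_mul_add_le (x y : B) :
    star (x + y) * (x + y) ≤ (2 : ℝ) • (star x * x) + (2 : ℝ) • (star y * y) := by
  rw [← sub_nonneg]
  convert star_mul_self_nonneg (x - y) using 1
  rw [star_add, star_sub, two_smul, two_smul]
  noncomm_ring

/-- A positive tracial functional on a simple algebra is faithful. -/
lemma CStarSimple.faithful (hB : CStarSimple B) (S : B →ₗ[ℝ] ℝ) (hpos : ∀ x, 0 ≤ x → 0 ≤ S x)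
    (hcomm : ∀ x y, S (x * y) = S (y * x)) (hone : S 1 = 1) {x : B}
    (hx : S (star x * x) = 0) : x = 0 := by
  have hmono : ∀ {u v : B}, u ≤ v → S u ≤ S v := by
    intro u v h
    rw [← sub_nonneg, ← map_sub]
    exact hpos _ (sub_nonneg.2 h)
  have hnn : ∀ u : B, 0 ≤ S (star u * u) := fun u => hpos _ (star_mul_self_nonneg u)
  have hleft : ∀ {u v : B}, S (star v * v) = 0 → S (star (u * v) * (u * v)) = 0 := by
    intro u v h
    refine le_antisymm ((hmono (star_mul_self_mul_le u v)).trans ?_) (hnn _)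
    rw [map_smul, h, smul_zero]
  have hstar : ∀ {u : B}, S (star u * u) = 0 → S (star (star u) * star u) = 0 := by
    intro u h
    rw [hcomm, star_star, h]
  let I : TwoSidedIdeal B := TwoSidedIdeal.mk' {u | S (star u * u) = 0} (by simp)
    (fun {u v} hu hv => by
      have hu' : S (star u * u) = 0 := hu
      have hv' : S (star v * v) = 0 := hv
      refine le_antisymm ((hmono (star_add_mul_add_le u v)).trans ?_) (hnn _)
      rw [map_add, map_smul, map_smul, hu', hv', smul_zero, add_zero])
    (fun {u} hu => by
      have hu' : S (star u * u) = 0 := hu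
      change S (star (-u) * (-u)) = 0
      rw [star_neg, neg_mul_neg, hu'])
    (fun {u v} hv => hleft hv)
    (fun {u v} hu => by
      have h := hstar (hleft (u := star v) (hstar hu))
      simpa using h)
  have hmem : ∀ u, u ∈ I ↔ S (star u * u) = 0 := fun u => by
    simp only [I, TwoSidedIdeal.mem_mk']
    rfl
  have hclosed : IsClosed (I : Set B) := by
    refine isClosed_of_closure_subset fun u hu => ?_
    rw [SetLike.mem_coe, hmem]
    refine le_antisymm (le_of_forall_pos_le_add fun ε hε => ?_) (hnn u)
    obtain ⟨z, hz, hdist⟩ := Metric.mem_closure_iff.1 hu (√(ε / 2)) (by positivity)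
    rw [SetLike.mem_coe, hmem] at hz
    rw [dist_eq_norm] at hdist
    have h1 := hmono (star_add_mul_add_le z (u - z))
    have h2 : S (star (u - z) * (u - z)) ≤ ε / 2 := by
      have h3 : star (u - z) * (u - z) ≤ algebraMap ℝ B (ε / 2) := by
        refine le_algebraMap_of_norm_le (IsSelfAdjoint.star_mul_self _) ?_
        rw [CStarRing.norm_star_mul_self]
        calc _ ≤ √(ε / 2) * √(ε / 2) := by gcongr
          _ = ε / 2 := Real.mul_self_sqrt (by positivity)
      have h4 := hmono h3
      rwa [Algebra.algebraMap_eq_smul_one, map_smul, hone, smul_eq_mul, mul_one] at h4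
    rw [add_sub_cancel, map_add, map_smul, map_smul, hz, smul_zero, zero_add, smul_eq_mul] at h1
    linarith
  have hIbot : I = ⊥ := by
    rcases hB I hclosed with h | h
    · exact h
    · exfalso
      have : (1 : B) ∈ I := h ▸ (by trivial)
      rw [hmem, star_one, one_mul, hone] at this
      exact one_ne_zero this
  have := (hmem x).2 hx
  rw [hIbot] at this
  simpa using this

end Faithful

section ContinuousTraces

variable {A : Type*} [CStarAlgebra A] [PartialOrder A] [StarOrderedRing A]
variable {Y : Type*} [TopologicalSpace Y] [CompactSpace Y]

lemma IsTracialState.const_pos (hA : CStarSimple A) {τ : C(Y, A) → ℂ} (hτ : IsTracialState τ)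
    {q : A} (hq : 0 ≤ q) (hq0 : q ≠ 0) : 0 < hτ.toLinearMap (ContinuousMap.const Y q) := by
  have h0 : ∀ x : A, 0 ≤ x → 0 ≤ hτ.toLinearMap (ContinuousMap.const Y x) := fun x hx =>
    (hτ.2.2.2.1 _ (const_nonneg hx)).1
  refine lt_of_le_of_ne (h0 q hq) fun h => hq0 ?_
  let S : A →ₗ[ℝ] ℝ :=
    { toFun := fun x => hτ.toLinearMap (ContinuousMap.const Y x)
      map_add' := fun x y => by rw [← map_add]; rfl
      map_smul' := fun c x => by rw [RingHom.id_apply, ← map_smul]; rfl }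
  have := hA.faithful S h0
    (fun x y => hτ.toLinearMap_mul_comm (ContinuousMap.const Y x) (ContinuousMap.const Y y))
    hτ.toLinearMap_one
    (x := CFC.sqrt q) (by
      rw [star_sqrt, CFC.sqrt_mul_sqrt_self q hq]
      exact h.symm)
  rw [← CFC.sqrt_mul_sqrt_self q hq, this, mul_zero]

lemma toLinearMap_smul_softSupport_star_mul {τ : C(Y, A) → ℂ} (hτ : IsTracialState τ)
    (φ : C(Y, ℝ)) (x : C(Y, A)) {δ : ℝ} (hδ : 0 < δ) :
    hτ.toLinearMap (φ • softSupport δ (x * star x))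
      = hτ.toLinearMap (φ • softSupport δ (star x * x)) := by
  rw [softSupport_eq_mul' (mul_star_self_nonneg x) hδ, softSupport_eq_mul'
    (star_mul_self_nonneg x) hδ, ← mul_assoc, ← mul_resolventPos_star_mul x hδ]
  have e1 : φ • (x * resolventPos δ (star x * x) * star x)
      = x * (φ • (resolventPos δ (star x * x) * star x)) := by
    ext y
    simp [mul_assoc]
  have e2 : φ • (resolventPos δ (star x * x) * (star x * x))
      = (φ • (resolventPos δ (star x * x) * star x)) * x := by
    ext y
    simp [mul_assoc]
  rw [e1, e2]
  exact hτ.toLinearMap_mul_comm _ _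

/-- Pointwise Cuntz subequivalence controls the traces of soft supports. -/
lemma IsTracialState.exists_softSupport_le [T2Space Y] {τ : C(Y, A) → ℂ} (hτ : IsTracialState τ)
    {f g : C(Y, A)} (hf : 0 ≤ f) (hg : 0 ≤ g) (hfg : ∀ y, CuntzLE (f y) (g y)) {δ η : ℝ}
    (hδ : 0 < δ) (hη : 0 < η) :
    ∃ δ' : ℝ, 0 < δ' ∧
      hτ.toLinearMap (softSupport δ f) ≤ hτ.toLinearMap (softSupport δ' g) + η := by
  choose v hv using fun y => cuntzLE_iff.1 (hfg y) (η * δ) (by positivity)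
  set U : Y → Set Y := fun y => {z | ‖v y * g z * star (v y) - f z‖ < η * δ} with hU
  have hUo : ∀ y, IsOpen (U y) := fun y => isOpen_lt (by fun_prop) continuous_const
  obtain ⟨F, hF⟩ := isCompact_univ.elim_finite_subcover U hUo
    (fun y _ => Set.mem_iUnion.2 ⟨y, hv y⟩)
  obtain ⟨ρ, hρ⟩ := PartitionOfUnity.exists_isSubordinate (isClosed_univ (X := Y))
    (fun i : F => U i) (fun i => hUo i) (by
      intro y hy
      obtain ⟨i, hi⟩ := Set.mem_iUnion.1 (hF hy)
      obtain ⟨hiF, hi⟩ := Set.mem_iUnion.1 hi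
      exact Set.mem_iUnion.2 ⟨⟨i, hiF⟩, hi⟩)
  have hsum : ∀ k : C(Y, A), ∑ i : F, (ρ i) • k = k := by
    intro k
    ext y
    rw [ContinuousMap.sum_apply]
    simp only [ContinuousMap.smul_apply']
    rw [← Finset.sum_smul, ← finsum_eq_sum_of_fintype, ρ.sum_eq_one (Set.mem_univ y), one_smul]
  obtain ⟨C, hC0, hC⟩ : ∃ C : ℝ, 0 < C ∧ ∀ i : F, ‖v i‖ ^ 2 ≤ C := by
    refine ⟨∑ i : F, ‖v i‖ ^ 2 + 1, by positivity, fun i => ?_⟩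
    have := Finset.single_le_sum (f := fun i : F => ‖v i‖ ^ 2) (fun i _ => by positivity)
      (Finset.mem_univ i)
    linarith
  have hδC : 0 < δ / C := by positivity
  refine ⟨δ / C, hδC, ?_⟩
  have hmono : ∀ (i : F) {k l : C(Y, A)}, (∀ y ∈ U i, k y ≤ l y) →
      hτ.toLinearMap (ρ i • k) ≤ hτ.toLinearMap (ρ i • l) := by
    intro i k l h
    refine hτ.toLinearMap_mono fun y => ?_
    change ρ i y • k y ≤ ρ i y • l y
    by_cases hy : y ∈ U i
    · exact smul_le_smul_of_nonneg_left (h y hy) (ρ.nonneg i y)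
    · have : ρ i y = 0 := by
        by_contra h0
        exact hy (hρ i (subset_closure h0))
      rw [this, zero_smul, zero_smul]
  have hloc : ∀ i : F, hτ.toLinearMap (ρ i • softSupport δ f)
      ≤ hτ.toLinearMap (ρ i • (softSupport (δ / C) g + algebraMap ℝ C(Y, A) η)) := by
    intro i
    set x : C(Y, A) := ContinuousMap.const Y (v i) * CFC.sqrt g with hx
    have hxx : x * star x =
        ContinuousMap.const Y (v i) * g * star (ContinuousMap.const Y (v i)) := by
      rw [hx, star_mul, star_sqrt]
      calc _ = ContinuousMap.const Y (v i) * (CFC.sqrt g * CFC.sqrt g)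
            * star (ContinuousMap.const Y (v i)) := by noncomm_ring
        _ = _ := by rw [CFC.sqrt_mul_sqrt_self g hg]
    have hxx0 := mul_star_self_nonneg x
    have h1 : hτ.toLinearMap (ρ i • softSupport δ f)
        ≤ hτ.toLinearMap (ρ i • (softSupport δ (x * star x) + algebraMap ℝ C(Y, A) η)) := by
      refine hmono i fun y hy => ?_
      have hsa : IsSelfAdjoint (f y - (x * star x) y) :=
        (IsSelfAdjoint.of_nonneg (hf y)).sub (IsSelfAdjoint.of_nonneg (hxx0 y))
      have hle : f y ≤ (x * star x) y + algebraMap ℝ A (η * δ) := by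
        rw [← sub_le_iff_le_add']
        refine le_algebraMap_of_norm_le hsa ?_
        rw [norm_sub_rev, hxx]
        exact le_of_lt hy
      rw [ContinuousMap.add_apply, softSupport_apply hf hδ, softSupport_apply hxx0 hδ,
        algebraMap_continuousMap_apply]
      have h2 := (softSupport_mono (hf y) hle hδ).trans
        (softSupport_add_algebraMap_le (hxx0 y) (by positivity) hδ)
      rwa [mul_div_cancel_right₀ _ hδ.ne'] at h2
    refine h1.trans ?_
    rw [smul_add, smul_add, map_add, map_add, toLinearMap_smul_softSupport_star_mul hτ _ _ hδ]
    refine add_le_add_left (hmono i fun y _ => ?_) _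
    have hxg : star x * x ≤ C • g := by
      have hs := CFC.sqrt_mul_sqrt_self g hg
      have h3 := star_mul_self_mul_le (ContinuousMap.const Y (v i)) (CFC.sqrt g)
      rw [star_sqrt, hs] at h3
      refine h3.trans (smul_le_smul_of_nonneg_right ?_ hg)
      refine le_trans ?_ (hC i)
      gcongr
      exact (ContinuousMap.norm_le _ (norm_nonneg _)).2 fun _ => le_rfl
    have h4 := softSupport_mono (star_mul_self_nonneg x) hxg hδ
    rw [softSupport_smul hg hC0 hδ] at h4
    exact h4 y
  calc hτ.toLinearMap (softSupport δ f)
      = ∑ i : F, hτ.toLinearMap (ρ i • softSupport δ f) := by rw [← map_sum, hsum]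
    _ ≤ ∑ i : F, hτ.toLinearMap (ρ i • (softSupport (δ / C) g + algebraMap ℝ C(Y, A) η)) :=
        Finset.sum_le_sum fun i _ => hloc i
    _ = _ := by
        rw [← map_sum, hsum, map_add]
        exact congrArg _ (hτ.toLinearMap_algebraMap η)

end ContinuousTraces

section Noncompact

variable {B : Type*} [CStarAlgebra B]

lemma mul_eq_zero_of_mem_closedLeftIdeal {x b s : B} (hx : x ∈ closedLeftIdeal b)
    (hs : b * s = 0) : x * s = 0 := by
  rw [← norm_eq_zero]
  refine le_antisymm (le_of_forall_pos_le_add fun ε hε => ?_) (norm_nonneg _)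
  obtain ⟨y, hy⟩ := mem_closedLeftIdeal_iff.1 hx (ε / (‖s‖ + 1)) (by positivity)
  have h : x * s = (x - y * b) * s := by rw [sub_mul, mul_assoc, hs, mul_zero, sub_zero]
  rw [h, zero_add]
  calc _ ≤ ‖x - y * b‖ * ‖s‖ := norm_mul_le _ _
    _ ≤ ε / (‖s‖ + 1) * (‖s‖ + 1) := by gcongr; linarith
    _ = ε := div_mul_cancel₀ _ (by positivity)

lemma IsProjection.mul_eq_zero_symm {p q : B} (hp : IsProjection p) (hq : IsProjection q)
    (h : p * q = 0) : q * p = 0 := by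
  have := congrArg star h
  rwa [star_mul, hp.1, hq.1, star_zero] at this

lemma IsProjection.add {p q : B} (hp : IsProjection p) (hq : IsProjection q) (h : p * q = 0) :
    IsProjection (p + q) := by
  refine ⟨by rw [star_add, hp.1, hq.1], ?_⟩
  rw [mul_add, add_mul, add_mul, hp.2, hq.2, h, hp.mul_eq_zero_symm hq h, add_zero, zero_add]

variable [PartialOrder B] [StarOrderedRing B]

/-- A positive element with no spectral gap at zero is not supported under a projection of its
hereditary subalgebra. -/
lemma corner_ne_zero {a s : B} (ha : 0 ≤ a)
    (hnc : ∀ ε : ℝ, 0 < ε → ∃ t : ℝ, t ∈ Set.Ioo 0 ε ∧ (t : ℂ) ∈ spectrum ℂ a)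
    (hs : IsProjection s) (hsa : s ∈ closedLeftIdeal a) : (1 - s) * a * (1 - s) ≠ 0 := by
  intro h0
  have hs1 := isProjection_one_sub hs
  have hr : a * (1 - s) = 0 := by
    have h1 : CFC.sqrt a * (1 - s) = 0 := by
      rw [← CStarRing.star_mul_self_eq_zero_iff, star_mul, star_sqrt, hs1.1]
      calc _ = (1 - s) * (CFC.sqrt a * CFC.sqrt a) * (1 - s) := by noncomm_ring
        _ = 0 := by rw [CFC.sqrt_mul_sqrt_self a ha, h0]
    rw [← CFC.sqrt_mul_sqrt_self a ha, mul_assoc, h1, mul_zero]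
  have hl : (1 - s) * a = 0 := by
    have := congrArg star hr
    rwa [star_mul, hs1.1, (IsSelfAdjoint.of_nonneg ha).star_eq, star_zero] at this
  have has : a * s = a := by rw [mul_sub, mul_one, sub_eq_zero] at hr; exact hr.symm
  have hsa' : s * a = a := by rw [sub_mul, one_mul, sub_eq_zero] at hl; exact hl.symm
  obtain ⟨y, hy⟩ := mem_closedLeftIdeal_iff.1 hsa (1 / 2) (by norm_num)
  set c : B := a + (1 - s) with hc
  have hcs : star c = c := by rw [hc, star_add, hs1.1, (IsSelfAdjoint.of_nonneg ha).star_eq]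
  have hprod : (s * y * s + (1 - s)) * c = 1 - s * (s - y * a) := by
    calc (s * y * s + (1 - s)) * c
        = s * y * (s * a) + s * y * s - s * y * (s * s) + (1 - s) * a + (1 - s) * (1 - s) := by
          rw [hc]; noncomm_ring
      _ = _ := by rw [hsa', hs.2, hl, hs1.2, mul_sub, hs.2]; noncomm_ring
  have hunit : IsUnit ((s * y * s + (1 - s)) * c) := by
    rw [hprod]
    refine isUnit_one_sub_of_norm_lt_one ?_
    calc _ ≤ ‖s‖ * ‖s - y * a‖ := norm_mul_le _ _
      _ ≤ 1 * (1 / 2) := by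
        gcongr
        exact norm_isProjection_le_one hs
      _ < 1 := by norm_num
  have hcunit : IsUnit c := by
    obtain ⟨u, hu⟩ := hunit
    set L : B := (↑u⁻¹ : B) * (s * y * s + (1 - s)) with hL
    have h1 : L * c = 1 := by rw [hL, mul_assoc, ← hu, Units.inv_mul]
    have h2 : c * star L = 1 := by
      have := congrArg star h1
      rwa [star_mul, hcs, star_one] at this
    exact ⟨⟨c, L, by rwa [left_inv_eq_right_inv h1 h2], h1⟩, rfl⟩
  have hev : ∀ᶠ t : ℝ in 𝓝 0, IsUnit (c - t • s) := by
    have hcont : Continuous fun t : ℝ => c - t • s := by fun_prop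
    refine hcont.continuousAt.eventually_mem (Units.isOpen.mem_nhds ?_)
    simpa using hcunit
  obtain ⟨ε, hε, hball⟩ := Metric.eventually_nhds_iff.1 hev
  obtain ⟨t, ht, htspec⟩ := hnc ε hε
  have ht0 : t ≠ 0 := ht.1.ne'
  have hu1 : IsUnit (c - t • s) := hball (by
    rw [Real.dist_eq, sub_zero, abs_of_pos ht.1]
    exact ht.2)
  have hs10 : s * (1 - s) = 0 := by rw [mul_sub, mul_one, hs.2, sub_self]
  have hs01 : (1 - s) * s = 0 := by rw [sub_mul, one_mul, hs.2, sub_self]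
  have hu2 : IsUnit (s - t • (1 - s)) := by
    have e : ∀ u v : ℝ, u * v = 1 → (s - u • (1 - s)) * (s - v • (1 - s)) = 1 := by
      intro u v huv
      rw [mul_sub, sub_mul, sub_mul, mul_smul_comm, smul_mul_assoc, smul_mul_smul_comm, hs.2, hs1.2,
        hs10, hs01, huv]
      simp
    exact ⟨⟨_, _, e t t⁻¹ (mul_inv_cancel₀ ht0), e t⁻¹ t (inv_mul_cancel₀ ht0)⟩, rfl⟩
  have hfac : (c - t • s) * (s - t • (1 - s)) = a - algebraMap ℂ B t := by
    have e1 : algebraMap ℂ B t = t • (1 : B) := by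
      rw [Algebra.algebraMap_eq_smul_one, Complex.coe_smul]
    rw [e1, mul_sub, sub_mul, mul_smul_comm, sub_mul, smul_mul_assoc, smul_mul_assoc, hs10, hs.2,
      hc, add_mul, add_mul, has, hr, hs01, hs1.2, smul_zero]
    module
  refine htspec ?_
  rw [spectrum.mem_resolventSet_iff, ← IsUnit.neg_iff, neg_sub, ← hfac]
  exact hu1.mul hu2

omit [PartialOrder B] [StarOrderedRing B] in
lemma corner_mem_closedLeftIdeal {a b s : B} (ha : a ∈ closedLeftIdeal b)
    (hs : s ∈ closedLeftIdeal b) : (1 - s) * a * (1 - s) ∈ closedLeftIdeal b := by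
  rw [mul_sub, mul_one, mul_assoc, ← mul_sub]
  exact Ideal.mul_mem_left _ _ (sub_mem ha (Ideal.mul_mem_left _ _ hs))

lemma RealRankZero.exists_orthogonal_projection (hRR : RealRankZero B) {a s : B} (ha : 0 ≤ a)
    (hs : IsProjection s) (hsa : s ∈ closedLeftIdeal a) {ε : ℝ} (hε : 0 < ε) :
    ∃ q : B, IsProjection q ∧ q ∈ closedLeftIdeal a ∧ s * q = 0 ∧
      ‖(1 - q) * ((1 - s) * a * (1 - s)) * (1 - q)‖ ≤ ε := by
  have hs1 := isProjection_one_sub hs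
  have ha' : 0 ≤ (1 - s) * a * (1 - s) := by
    have := star_left_conjugate_nonneg ha (1 - s)
    rwa [hs1.1] at this
  obtain ⟨q, hq, hqa, hle⟩ := hRR.exists_projection ha' hε
  refine ⟨q, hq, closedLeftIdeal_le
    (corner_mem_closedLeftIdeal (self_mem_closedLeftIdeal a) hsa) hqa, ?_, hle⟩
  refine hq.mul_eq_zero_symm hs (mul_eq_zero_of_mem_closedLeftIdeal hqa ?_)
  rw [mul_assoc, sub_mul 1 s s, one_mul, hs.2, sub_self, mul_zero]

end Noncompact

section Construction

variable {A : Type*} [CStarAlgebra A] [PartialOrder A] [StarOrderedRing A]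
variable {Y : Type*} [TopologicalSpace Y] [CompactSpace Y] [T2Space Y]

/-- A strict gap between projections below `H` persists after cutting `H` down by a partial
isometry implementing the smaller one. -/
lemma dTr_lt_dTr_corner (hA : CStarSimple A) {H U : C(Y, A)} (hH : 0 ≤ H) {s q r : A}
    (hs : IsProjection s) (hq : IsProjection q) (hr : IsProjection r) (hr0 : r ≠ 0)
    (hsqr : IsProjection (s + q + r)) (hle : ∀ y, CuntzLE (s + q + r) (H y))
    (hU : star U * U = ContinuousMap.const Y s) {τ : C(Y, A) → ℂ} (hτ : IsTracialState τ) :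
    dTr τ (ContinuousMap.const Y q)
      < dTr τ ((1 - U * star U) * H * (1 - U * star U)) := by
  set T := hτ.toLinearMap with hT
  have hR := (isProjection_mul_star (hs.const (Y := Y)) hU).1
  have hTR : T (U * star U) = T (ContinuousMap.const Y s) := by
    rw [hT, hτ.toLinearMap_mul_comm, hU]
  set K := (1 - U * star U) * H * (1 - U * star U) with hK
  have hK0 : 0 ≤ K := by
    have := star_left_conjugate_nonneg hH (1 - U * star U)
    rwa [(isProjection_one_sub hR).1] at this
  have hrpos := hτ.const_pos hA hr.nonneg hr0
  set t : C(Y, A) := ContinuousMap.const Y (s + q + r) with ht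
  have htp : IsProjection t := hsqr.const
  have htT : T t = T (ContinuousMap.const Y s) + T (ContinuousMap.const Y q)
      + T (ContinuousMap.const Y r) := by
    rw [← map_add, ← map_add]
    rfl
  have hbound : T t ≤ T (ContinuousMap.const Y s) + dTr τ K := by
    refine le_of_forall_pos_le_add fun ε hε => ?_
    have hη : 0 < ε / 2 := half_pos hε
    obtain ⟨δ, hδ, h1⟩ := hτ.exists_softSupport_le htp.nonneg hH hle hη hη
    have h2 := hτ.toLinearMap_mono (softSupport_le_add_corner hH hR hδ)
    rw [map_add, ← hT, hTR, ← hK] at h2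
    have h3 := hτ.softSupport_le_dTr hK0 (half_pos hδ)
    have h4 : softSupport (ε / 2) t = (1 / (1 + ε / 2)) • t := by
      have := softSupport_smul_isProjection htp zero_le_one hη
      rwa [one_smul] at this
    have h5 : T t ≤ 1 := by
      have h6 := hτ.toLinearMap_mono (sub_nonneg.1 (isProjection_one_sub htp).nonneg)
      rwa [hτ.toLinearMap_one] at h6
    have h7 : 0 ≤ T t := (hτ.2.2.2.1 _ htp.nonneg).1
    rw [h4, map_smul, smul_eq_mul, ← hT] at h1
    have h8 : T t - ε / 2 ≤ 1 / (1 + ε / 2) * T t := by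
      rw [one_div, ← div_eq_inv_mul, le_div_iff₀ (by positivity)]
      nlinarith
    linarith
  rw [hτ.dTr_eq_of_isProjection hq.const]
  linarith

/-- Inductive step: enlarge a partial isometry into the hereditary subalgebra generated by `H`. -/
lemma exists_extension (hA : CStarSimple A) (hRR : RealRankZero A) (hSC : StrictComparison C(Y, A))
    {a : A} (ha : 0 ≤ a)
    (hnc : ∀ ε : ℝ, 0 < ε → ∃ t : ℝ, t ∈ Set.Ioo 0 ε ∧ (t : ℂ) ∈ spectrum ℂ a)
    {H : C(Y, A)} (hH : 0 ≤ H) (haH : ∀ y, CuntzLE a (H y)) {s : A} (hs : IsProjection s)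
    (hsa : s ∈ closedLeftIdeal a) {U : C(Y, A)} (hU : star U * U = ContinuousMap.const Y s)
    (hUH : star U ∈ closedLeftIdeal H) {ε : ℝ} (hε : 0 < ε) :
    ∃ (s' : A) (U' : C(Y, A)), IsProjection s' ∧ s' ∈ closedLeftIdeal a ∧
      star U' * U' = ContinuousMap.const Y s' ∧ star U' ∈ closedLeftIdeal H ∧
      U' * ContinuousMap.const Y s = U ∧ s' * s = s ∧ ‖(1 - s') * a * (1 - s')‖ ≤ ε := by
  obtain ⟨q, hq, hqa, hsq, hle⟩ := hRR.exists_orthogonal_projection ha hs hsa hε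
  have hqs := hs.mul_eq_zero_symm hq hsq
  have hs' := hs.add hq hsq
  have hs'a : s + q ∈ closedLeftIdeal a := add_mem hsa hqa
  have hne := corner_ne_zero ha hnc hs' hs'a
  obtain ⟨r, hr, hra, hsr, hrle⟩ := hRR.exists_orthogonal_projection ha hs' hs'a
    (half_pos (norm_pos_iff.2 hne))
  have hr0 : r ≠ 0 := by
    rintro rfl
    rw [sub_zero, one_mul, mul_one] at hrle
    linarith [norm_pos_iff.2 hne]
  have hsqr := hs'.add hr hsr
  have hsqra : s + q + r ∈ closedLeftIdeal a := add_mem hs'a hra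
  have hcle : ∀ y, CuntzLE (s + q + r) (H y) := fun y =>
    (cuntzLE_of_mem hsqr.nonneg ha hsqra).trans (haH y)
  obtain ⟨hR, hUs⟩ := isProjection_mul_star (hs.const (Y := Y)) hU
  have hR1 := isProjection_one_sub hR
  set R := U * star U with hRdef
  set K := (1 - R) * H * (1 - R) with hK
  have hK0 : 0 ≤ K := by
    have := star_left_conjugate_nonneg hH (1 - R)
    rwa [hR1.1] at this
  have hRH : R ∈ closedLeftIdeal H := Ideal.mul_mem_left _ _ hUH
  have hKH : K ∈ closedLeftIdeal H := corner_mem_closedLeftIdeal (self_mem_closedLeftIdeal H) hRH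
  obtain ⟨w, c, hw, hww⟩ := exists_partial_isometry_of_cuntzLE (hq.const (Y := Y)) hK0
    (hSC _ _ hq.const.nonneg hK0 fun τ hτ =>
      dTr_lt_dTr_corner hA hH hs hq hr hr0 hsqr hcle hU hτ)
  have hsqrtK := sqrt_mem_closedLeftIdeal hK0 (self_mem_closedLeftIdeal K)
  have hRw : R * w = 0 := by
    have h1 : CFC.sqrt K * R = 0 := by
      refine mul_eq_zero_of_mem_closedLeftIdeal hsqrtK ?_
      rw [hK, mul_assoc, sub_mul 1 R R, one_mul, hR.2, sub_self, mul_zero]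
    have h2 := congrArg star h1
    rw [star_mul, star_sqrt, hR.1, star_zero] at h2
    rw [hw, ← mul_assoc, h2, zero_mul]
  have hUR : star U * R = star U := by
    rw [hRdef, ← mul_assoc, hU]
    have := congrArg star hUs
    rwa [star_mul, hs.const.1] at this
  have hUw : star U * w = 0 := by rw [← hUR, mul_assoc, hRw, mul_zero]
  have hwU : star w * U = 0 := by
    have := congrArg star hUw
    rwa [star_mul, star_star, star_zero] at this
  refine ⟨s + q, U + w, hs', hs'a, ?_, ?_, ?_, ?_, ?_⟩
  · rw [star_add, add_mul, mul_add, mul_add, hU, hww, hUw, hwU, add_zero, zero_add]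
    rfl
  · rw [star_add, hw, star_mul, star_sqrt]
    exact add_mem hUH (Ideal.mul_mem_left _ _ (closedLeftIdeal_le hKH hsqrtK))
  · have h1 : w * ContinuousMap.const Y s = 0 := by
      have h2 : ContinuousMap.const Y q * ContinuousMap.const Y s = 0 := by
        ext y
        exact hqs
      rw [← (isProjection_mul_star hq.const hww).2, mul_assoc, h2, mul_zero]
    rw [add_mul, hUs, h1, add_zero]
  · rw [add_mul, hs.2, hqs, add_zero]
  · have h1 : (1 - s) * (1 - q) = 1 - (s + q) := by
      rw [mul_sub, sub_mul, sub_mul, hsq]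
      noncomm_ring
    have h2 : (1 - q) * (1 - s) = 1 - (s + q) := by
      rw [mul_sub, sub_mul, sub_mul, hqs]
      noncomm_ring
    have h3 : (1 - q) * ((1 - s) * a * (1 - s)) * (1 - q)
        = (1 - (s + q)) * a * (1 - (s + q)) := by
      calc _ = ((1 - q) * (1 - s)) * a * ((1 - s) * (1 - q)) := by simp only [mul_assoc]
        _ = _ := by rw [h1, h2]
    rwa [h3] at hle

/-- If `a ≾ H(y)` for all `y` and `a` has no spectral gap at zero, then the hereditary subalgebra
generated by `H` contains an element which is pointwise Cuntz equivalent to `a`. -/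
lemma exists_mem_closedLeftIdeal_cuntzEquiv (hA : CStarSimple A) (hRR : RealRankZero A)
    (hSC : StrictComparison C(Y, A)) {a : A} (ha : 0 ≤ a)
    (hnc : ∀ ε : ℝ, 0 < ε → ∃ t : ℝ, t ∈ Set.Ioo 0 ε ∧ (t : ℂ) ∈ spectrum ℂ a)
    {H : C(Y, A)} (hH : 0 ≤ H) (haH : ∀ y, CuntzLE a (H y)) :
    ∃ F : C(Y, A), 0 ≤ F ∧ F ∈ closedLeftIdeal H ∧ ∀ y, CuntzEquiv (F y) a := by
  let P : A × C(Y, A) → Prop := fun z => IsProjection z.1 ∧ z.1 ∈ closedLeftIdeal a ∧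
    star z.2 * z.2 = ContinuousMap.const Y z.1 ∧ star z.2 ∈ closedLeftIdeal H
  have hstep : ∀ (n : ℕ) (z : {z // P z}), ∃ z' : {z // P z},
      z'.1.2 * ContinuousMap.const Y z.1.1 = z.1.2 ∧ z'.1.1 * z.1.1 = z.1.1 ∧
      ‖(1 - z'.1.1) * a * (1 - z'.1.1)‖ ≤ (1 / ((n : ℝ) + 1)) ^ 2 := by
    rintro n ⟨⟨s, U⟩, hs, hsa, hU, hUH⟩
    obtain ⟨s', U', hs', hsa', hU', hUH', h⟩ := exists_extension hA hRR hSC ha hnc hH haH hs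
      hsa hU hUH (ε := (1 / ((n : ℝ) + 1)) ^ 2) (by positivity)
    exact ⟨⟨(s', U'), hs', hsa', hU', hUH'⟩, h⟩
  choose next hnextU hnexts hnext using hstep
  let z0 : {z // P z} := ⟨(0, 0), ⟨star_zero _, mul_zero _⟩, zero_mem _, by rw [mul_zero]; rfl, by
    rw [star_zero]; exact zero_mem _⟩
  let z : ℕ → {z // P z} := fun n => Nat.rec z0 (fun n z => next n z) n
  set s : ℕ → A := fun n => (z n).1.1
  set U : ℕ → C(Y, A) := fun n => (z n).1.2
  have hs : ∀ n, IsProjection (s n) := fun n => (z n).2.1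
  have hU : ∀ n, star (U n) * U n = ContinuousMap.const Y (s n) := fun n => (z n).2.2.2.1
  have hUH : ∀ n, star (U n) ∈ closedLeftIdeal H := fun n => (z n).2.2.2.2
  have hle : ∀ {n m : ℕ}, n ≤ m → U m * ContinuousMap.const Y (s n) = U n ∧ s m * s n = s n := by
    intro n m hnm
    induction m, hnm using Nat.le_induction with
    | base => exact ⟨(isProjection_mul_star (hs n).const (hU n)).2, (hs n).2⟩
    | succ m hnm ih =>
      have h1 : U (m + 1) * ContinuousMap.const Y (s m) = U m := hnextU m (z m)
      have h2 : s (m + 1) * s m = s m := hnexts m (z m)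
      refine ⟨?_, ?_⟩
      · have h3 : ContinuousMap.const Y (s m) * ContinuousMap.const Y (s n)
            = ContinuousMap.const Y (s n) := by
          ext y
          exact ih.2
        rw [← h3, ← mul_assoc, h1, ih.1]
      · rw [← ih.2, ← mul_assoc, h2]
  set e : ℕ → ℝ := fun n => ‖(1 - s n) * CFC.sqrt a‖ with he
  have he0 : Tendsto e atTop (𝓝 0) := by
    refine (tendsto_add_atTop_iff_nat 1).1 (squeeze_zero (fun n => norm_nonneg _) (fun n => ?_)
      tendsto_one_div_add_atTop_nhds_zero_nat)
    refine le_of_sq_le_sq ?_ (by positivity)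
    have h1 := hnext n (z n)
    have h2 : e (n + 1) ^ 2 = ‖(1 - s (n + 1)) * a * (1 - s (n + 1))‖ := by
      simp only [he]
      rw [pow_two, ← CStarRing.norm_self_mul_star, star_mul, star_sqrt,
        (isProjection_one_sub (hs (n + 1))).1]
      congr 1
      nth_rewrite 3 [← CFC.sqrt_mul_sqrt_self a ha]
      noncomm_ring
    rw [h2]
    exact h1
  set x : C(Y, A) := ContinuousMap.const Y (CFC.sqrt a) with hx
  have hUn : ∀ n, ‖U n‖ ≤ 1 := by
    intro n
    have h1 := norm_isProjection_le_one ((hs n).const (Y := Y))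
    rw [← hU, CStarRing.norm_star_mul_self, ← pow_two] at h1
    exact (sq_le_one_iff₀ (norm_nonneg _)).1 h1
  have hdist : ∀ {n m : ℕ}, n ≤ m → dist (U m * x) (U n * x) ≤ e n := by
    intro n m hnm
    have h1 : U m * x - U n * x = U m * ContinuousMap.const Y ((1 - s n) * CFC.sqrt a) := by
      have h2 : ContinuousMap.const Y ((1 - s n) * CFC.sqrt a)
          = x - ContinuousMap.const Y (s n) * x := by
        ext y
        change (1 - s n) * CFC.sqrt a = CFC.sqrt a - s n * CFC.sqrt a
        rw [sub_mul, one_mul]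
      rw [h2, mul_sub, ← mul_assoc, (hle hnm).1]
    rw [dist_eq_norm, h1]
    calc _ ≤ ‖U m‖ * ‖ContinuousMap.const Y ((1 - s n) * CFC.sqrt a)‖ := norm_mul_le _ _
      _ ≤ 1 * e n := by
        gcongr
        · exact hUn m
        · exact (ContinuousMap.norm_le _ (norm_nonneg _)).2 fun _ => le_rfl
      _ = e n := one_mul _
  have hcauchy : CauchySeq fun n => U n * x := by
    refine cauchySeq_of_le_tendsto_0 (fun n => e n + e n) (fun n m N hn hm => ?_)
      (by simpa using he0.add he0)
    exact (dist_triangle_right _ _ (U N * x)).trans (add_le_add (hdist hn) (hdist hm))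
  obtain ⟨W, hW⟩ := cauchySeq_tendsto_of_complete hcauchy
  have hxs : star x = x := by
    ext y
    exact star_sqrt a
  have hWW : star W * W = ContinuousMap.const Y a := by
    refine tendsto_nhds_unique (hW.star.mul hW) (tendsto_iff_norm_sub_tendsto_zero.2 ?_)
    refine squeeze_zero (fun n => norm_nonneg _) (fun n => ?_)
      (by simpa using he0.const_mul ‖CFC.sqrt a‖)
    have h1 : star (U n * x) * (U n * x) - ContinuousMap.const Y a
        = ContinuousMap.const Y (-(CFC.sqrt a * ((1 - s n) * CFC.sqrt a))) := by
      rw [star_mul, hxs]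
      have h2 : x * star (U n) * (U n * x) = x * ContinuousMap.const Y (s n) * x := by
        rw [← hU]
        noncomm_ring
      rw [h2]
      ext y
      change CFC.sqrt a * s n * CFC.sqrt a - a = -(CFC.sqrt a * ((1 - s n) * CFC.sqrt a))
      nth_rewrite 3 [← CFC.sqrt_mul_sqrt_self a ha]
      noncomm_ring
    rw [h1]
    refine (ContinuousMap.norm_le _ (by positivity)).2 fun y => ?_
    change ‖-(CFC.sqrt a * ((1 - s n) * CFC.sqrt a))‖ ≤ _
    rw [norm_neg]
    exact norm_mul_le _ _
  refine ⟨W * star W, mul_star_self_nonneg W, ?_, fun y => ?_⟩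
  · refine (isClosed_closedLeftIdeal H).mem_of_tendsto (hW.mul hW.star)
      (Eventually.of_forall fun n => ?_)
    rw [star_mul, ← mul_assoc]
    exact Ideal.mul_mem_left _ _ (hUH n)
  · have h1 := cuntzEquiv_mul_star_star_mul (W y)
    have h2 : star (W y) * W y = a := congrArg (fun f : C(Y, A) => f y) hWW
    rw [h2] at h1
    exact h1

end Construction

section Paths

variable {A : Type*} [CStarAlgebra A] [PartialOrder A] [StarOrderedRing A]
variable {X : Type*} [TopologicalSpace X] [CompactSpace X]

lemma cuntzLE_of_smul_le {b c : A} (hb : 0 ≤ b) (hc : 0 ≤ c) {r : ℝ} (hr : 0 < r)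
    (h : r • b ≤ c) : CuntzLE b c := by
  refine cuntzLE_of_le hb hc (C := r⁻¹) ?_
  have := smul_le_smul_of_nonneg_left h (inv_nonneg.2 hr.le)
  rwa [smul_smul, inv_mul_cancel₀ hr.ne', one_smul] at this

lemma joinedIn_of_mem_closedLeftIdeal {a : A} {f k : C(X, A)} (hf : 0 ≤ f)
    (hfa : ∀ x, CuntzEquiv (f x) a) (hk : 0 ≤ k) (hka : ∀ x, CuntzEquiv (k x) a)
    (hkf : ∀ x, k x ∈ closedLeftIdeal (f x)) :
    JoinedIn {f : C(X, A) | 0 ≤ f ∧ ∀ x, CuntzEquiv (f x) a} f k := by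
  refine JoinedIn.ofLine (f := fun t : ℝ => (1 - t) • f + t • k) (by fun_prop) (by simp)
    (by simp) ?_
  rintro _ ⟨t, ⟨ht0, ht1⟩, rfl⟩
  have ht1' : 0 ≤ 1 - t := sub_nonneg.2 ht1
  have hnn : ∀ x, 0 ≤ (1 - t) • f x + t • k x := fun x =>
    add_nonneg (smul_nonneg ht1' (hf x)) (smul_nonneg ht0 (hk x))
  refine ⟨hnn, fun x => ?_⟩
  change CuntzEquiv ((1 - t) • f x + t • k x) a
  rcases ht1.eq_or_lt with rfl | hlt
  · simpa using hka x
  · refine CuntzEquiv.trans ⟨cuntzLE_of_mem (hnn x) (hf x) ?_, ?_⟩ (hfa x)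
    · rw [← smul_one_mul (1 - t) (f x), ← smul_one_mul t (k x)]
      exact add_mem (Ideal.mul_mem_left _ _ (self_mem_closedLeftIdeal _))
        (Ideal.mul_mem_left _ _ (hkf x))
    · exact cuntzLE_of_smul_le (hf x) (hnn x) (sub_pos.2 hlt)
        (le_add_of_nonneg_right (smul_nonneg ht0 (hk x)))

end Paths

/-- **Theorem (main, stably finite non-compact case).**
Let `A` be a unital simple separable C*-algebra which is approximately divisible,
of real rank zero and stably finite, such that `C(X,A)` has strict comparison for
every compact metric space `X`.  If `a ∈ A` is a nonzero positive element whose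
Cuntz class is not compact (rendered spectrally: `σ(a) ∩ (0,ε) ≠ ∅` for all `ε > 0`),
then for every compact metric space `X` the set
`D_{a,X} = { f ∈ C(X,A) | f ≥ 0 and f(x) ∼ a for all x }` is path connected. -/
theorem cuntz_class_path_connected
    {A : Type*} [CStarAlgebra A] [PartialOrder A] [StarOrderedRing A]
    [TopologicalSpace.SeparableSpace A]
    (hSimple : CStarSimple A) (hAD : ApproxDivisible A)
    (hRR0 : RealRankZero A) (hSF : StablyFinite A)
    (hSC : ∀ (X : Type) [MetricSpace X] [CompactSpace X], StrictComparison C(X, A))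
    (a : A) (ha : 0 ≤ a) (ha0 : a ≠ 0)
    (hnc : ∀ ε : ℝ, 0 < ε → ∃ t : ℝ, t ∈ Set.Ioo 0 ε ∧ (t : ℂ) ∈ spectrum ℂ a)
    (X : Type) [MetricSpace X] [CompactSpace X] :
    IsPathConnected {f : C(X, A) | 0 ≤ f ∧ ∀ x : X, CuntzEquiv (f x) a} := by
  refine isPathConnected_iff.2 ⟨⟨ContinuousMap.const X a, fun _ => ha, fun _ => cuntzEquiv_refl a⟩,
    ?_⟩
  rintro f ⟨hf, hfa⟩ g ⟨hg, hga⟩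
  let H : C(X × unitInterval, A) :=
    ⟨fun y => (1 - (y.2 : ℝ)) • f y.1 + (y.2 : ℝ) • g y.1, by fun_prop⟩
  have hH : 0 ≤ H := fun y => add_nonneg (smul_nonneg (sub_nonneg.2 y.2.2.2) (hf y.1))
    (smul_nonneg y.2.2.1 (hg y.1))
  have haH : ∀ y, CuntzLE a (H y) := by
    rintro ⟨x, t⟩
    rcases t.2.1.eq_or_lt with h0 | h0
    · have : H (x, t) = f x := by simp [H, ← h0]
      rw [this]
      exact (hfa x).2
    · exact (hga x).2.trans (cuntzLE_of_smul_le (hg x) (hH (x, t)) h0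
        (le_add_of_nonneg_left (smul_nonneg (sub_nonneg.2 t.2.2) (hf x))))
  obtain ⟨F, hF, hFH, hFa⟩ :=
    exists_mem_closedLeftIdeal_cuntzEquiv hSimple hRR0 (hSC _) ha hnc hH haH
  let γ : C(unitInterval, C(X, A)) := (F.comp ContinuousMap.prodSwap).curry
  have hγ : JoinedIn {f : C(X, A) | 0 ≤ f ∧ ∀ x : X, CuntzEquiv (f x) a} (γ 0) (γ 1) :=
    ⟨⟨γ, rfl, rfl⟩, fun t => ⟨fun x => hF (x, t), fun x => hFa (x, t)⟩⟩
  have h0 : ∀ x, γ 0 x ∈ closedLeftIdeal (f x) := by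
    intro x
    have h : H (x, 0) = f x := by simp [H]
    exact h ▸ apply_mem_closedLeftIdeal hFH (x, 0)
  have h1 : ∀ x, γ 1 x ∈ closedLeftIdeal (g x) := by
    intro x
    have h : H (x, 1) = g x := by simp [H]
    exact h ▸ apply_mem_closedLeftIdeal hFH (x, 1)
  have hf0 := joinedIn_of_mem_closedLeftIdeal (k := γ 0) hf hfa (fun x => hF (x, 0))
    (fun x => hFa (x, 0)) h0
  have hg1 := joinedIn_of_mem_closedLeftIdeal (k := γ 1) hg hga (fun x => hF (x, 1))
    (fun x => hFa (x, 1)) h1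
  exact (hf0.trans hγ).trans hg1.symm
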